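/- Let N be a level-2 phylogenetic network on X with at least two blobs in which every leaf is contained in a blob, containing a pendant level-2 blob of the form (k, l, 0, 0) with chains a = (a_1, ..., a_k) and b = (b_1, ..., b_l) (k, l ≥ 1). Then for every x ∈ X \ (a ∪ b), the multiset d^{N}(x, a_1) can be uniquely partitioned into four equal-sized multisets A, B, C, D with A − 3 = B − (l+4) = C − (k+2) = D − (k+l+3). Moreover, replacing the pendant blob by a single new leaf z yields a network N' on X' = (X \ (a ∪ b)) ∪ {z} whose multisets of distances satisfy d^{N'}(x,y) = d^{N}(x,y) for all x, y ∈ X' \ {z} and d^{N'}(x,z) = A − 3 for all x ∈ X' \ {z}. -/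

import Mathlib

open SimpleGraph

/-- A labelled graph: the raw data of a phylogenetic network on a label set `X`:
a finite vertex type, a simple graph on it, and a labelling map from `X` to vertices. -/
structure LabGraph (X : Type) where
  V : Type
  [fV : Fintype V]
  G : SimpleGraph V
  leaf : X → V

attribute [instance] LabGraph.fV

namespace LabGraph

variable {X : Type} [Fintype X] [DecidableEq X]

/-- The shortest distance `d_m(x,y)` between the leaves labelled `x` and `y`. -/
noncomputable def dm (N : LabGraph X) (x y : X) : ℕ :=
  N.G.dist (N.leaf x) (N.leaf y)

/-- The multiset `d(x,y)` of the lengths of all paths between the leaves `x` and `y`. -/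
noncomputable def dms (N : LabGraph X) (x y : X) : Multiset ℕ := by
  classical
  exact (Finset.univ : Finset (N.G.Path (N.leaf x) (N.leaf y))).val.map fun p => p.1.length

/-- The degree of a vertex. -/
noncomputable def degOf (N : LabGraph X) (v : N.V) : ℕ := (N.G.neighborSet v).ncard

/-- `N` is an (unweighted unrooted binary) phylogenetic network on `X`:
it is connected, the labelling is injective, and either it is the singleton graph
(when `|X| = 1`), or every leaf-labelled vertex has degree 1 and every other
vertex has degree 3 (so the degree-1 vertices are exactly the labelled leaves). -/
def IsNetwork (N : LabGraph X) : Prop :=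
  N.G.Connected ∧ Function.Injective N.leaf ∧
    ((Fintype.card X = 1 ∧ Fintype.card N.V = 1) ∨
      ((∀ x : X, N.degOf (N.leaf x) = 1) ∧
        ∀ v : N.V, v ∉ Set.range N.leaf → N.degOf v = 3))

/-- Two labelled graphs on `X` are isomorphic by a graph isomorphism fixing the leaf labels. -/
def IsomLabelled (N M : LabGraph X) : Prop :=
  ∃ φ : N.G ≃g M.G, ∀ x : X, φ (N.leaf x) = M.leaf x

/-- A subgraph is 2-connected (with at least three vertices): it is connected and
remains connected after deleting any one of its vertices. -/
def TwoConnSub (N : LabGraph X) (H : N.G.Subgraph) : Prop :=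
  3 ≤ H.verts.ncard ∧ H.coe.Connected ∧
    ∀ v ∈ H.verts, (H.deleteVerts {v}).coe.Connected

/-- A blob: a maximal 2-connected subgraph with at least three vertices. -/
def IsBlob (N : LabGraph X) (H : N.G.Subgraph) : Prop :=
  N.TwoConnSub H ∧ ∀ H' : N.G.Subgraph, N.TwoConnSub H' → H ≤ H' → H' = H

/-- Exactly `r` edges must be deleted from the (connected) subgraph `H` to obtain a
tree: `|E(H)| - |V(H)| + 1 = r`.  A level-1 blob has rank 1, a level-2 blob rank 2. -/
def BlobRank (N : LabGraph X) (H : N.G.Subgraph) (r : ℕ) : Prop :=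
  H.edgeSet.ncard + 1 = H.verts.ncard + r

/-- A network is level-`k` if at most `k` edges must be deleted from every blob
to obtain a tree. -/
def IsLevel (N : LabGraph X) (k : ℕ) : Prop :=
  ∀ H : N.G.Subgraph, N.IsBlob H → H.edgeSet.ncard + 1 ≤ H.verts.ncard + k

/-- A cut-edge: an edge whose deletion disconnects the graph. -/
def IsCutEdge (N : LabGraph X) (e : Sym2 N.V) : Prop :=
  e ∈ N.G.edgeSet ∧ ¬ (N.G.deleteEdges {e}).Connected

/-- A trivial (cut-)edge: one incident to a leaf. -/
def TrivialEdge (N : LabGraph X) (e : Sym2 N.V) : Prop :=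
  ∃ x : X, N.leaf x ∈ e

/-- An edge is incident to a blob if one of its endpoints is a vertex of the blob. -/
def EdgeIncBlob (N : LabGraph X) (e : Sym2 N.V) (H : N.G.Subgraph) : Prop :=
  ∃ v ∈ H.verts, v ∈ e

/-- A pendant blob: a blob with exactly one incident non-trivial cut-edge. -/
def IsPendantBlob (N : LabGraph X) (H : N.G.Subgraph) : Prop :=
  N.IsBlob H ∧
    ∃! e : Sym2 N.V, N.IsCutEdge e ∧ ¬ N.TrivialEdge e ∧ N.EdgeIncBlob e H

/-- A leaf is contained in a blob if its neighbour is a vertex of the blob. -/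
def LeafInBlob (N : LabGraph X) (x : X) (H : N.G.Subgraph) : Prop :=
  ∃ v : N.V, N.G.Adj (N.leaf x) v ∧ v ∈ H.verts

/-- `N` has at least two blobs. -/
def TwoBlobs (N : LabGraph X) : Prop :=
  ∃ H₁ H₂ : N.G.Subgraph, N.IsBlob H₁ ∧ N.IsBlob H₂ ∧ H₁ ≠ H₂

/-- Every leaf of `N` is contained in a blob. -/
def AllLeavesInBlobs (N : LabGraph X) : Prop :=
  ∀ x : X, ∃ H : N.G.Subgraph, N.IsBlob H ∧ N.LeafInBlob x H

/-- A chain: a `k`-tuple of leaves with consecutive shortest distances equal to 3. -/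
def IsChainT (N : LabGraph X) (k : ℕ) (a : Fin k → X) : Prop :=
  ∀ (i : ℕ) (h : i + 1 < k),
    N.dm (a ⟨i, Nat.lt_of_succ_lt h⟩) (a ⟨i + 1, h⟩) = 3

/-- A maximal chain: a chain whose leaf set is not properly contained in the leaf
set of another chain. -/
def IsMaxChainT (N : LabGraph X) (k : ℕ) (a : Fin k → X) : Prop :=
  N.IsChainT k a ∧ ∀ (l : ℕ) (b : Fin l → X), N.IsChainT l b →
    Set.range a ⊆ Set.range b → Set.range a = Set.range b

/-- The chain `a` is contained in the blob `H`: the edges between the neighbours of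
consecutive chain leaves are edges of `H`. -/
def ChainInBlob (N : LabGraph X) (k : ℕ) (a : Fin k → X) (H : N.G.Subgraph) : Prop :=
  ∀ (i : ℕ) (h : i + 1 < k) (p q : N.V),
    N.G.Adj (N.leaf (a ⟨i, Nat.lt_of_succ_lt h⟩)) p →
    N.G.Adj (N.leaf (a ⟨i + 1, h⟩)) q → H.Adj p q

/-- The multiset of natural numbers `A`, viewed in `ℤ`. -/
def toZ (A : Multiset ℕ) : Multiset ℤ := A.map (fun t => (t : ℤ))

/-- `A - n`: subtract `n` from every element of the multiset `A` (in `ℤ`). -/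
def zsub (A : Multiset ℕ) (n : ℤ) : Multiset ℤ := A.map (fun t => (t : ℤ) - n)

/-- The branch vertices of a blob `H`: its vertices of degree at least 3 in `H`. -/
def branchVerts (N : LabGraph X) (H : N.G.Subgraph) : Set N.V :=
  {w | w ∈ H.verts ∧ 3 ≤ (H.neighborSet w).ncard}

/-- `p` and `q` lie on a common side of the blob `H`: they are non-branch vertices of `H`
that are connected in `H` after deleting all branch vertices. -/
def SameSide (N : LabGraph X) (H : N.G.Subgraph) (p q : N.V) : Prop :=
  ∃ (hp : p ∈ (H.deleteVerts (N.branchVerts H)).verts)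
    (hq : q ∈ (H.deleteVerts (N.branchVerts H)).verts),
    (H.deleteVerts (N.branchVerts H)).coe.Reachable ⟨p, hp⟩ ⟨q, hq⟩

/-- `p` and `q` are separated by the vertex `u` within the sides of the blob `H`:
they are not connected in `H` after deleting all branch vertices and `u`. -/
def SepBy (N : LabGraph X) (H : N.G.Subgraph) (u p q : N.V) : Prop :=
  ¬ ∃ (hp : p ∈ (H.deleteVerts (N.branchVerts H ∪ {u})).verts)
      (hq : q ∈ (H.deleteVerts (N.branchVerts H ∪ {u})).verts),
      (H.deleteVerts (N.branchVerts H ∪ {u})).coe.Reachable ⟨p, hp⟩ ⟨q, hq⟩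

/-- The pendant level-2 blob `H` is of the form `(k, l, m, n)`, witnessed by the chains
`a, b, c, d` and the non-trivial cut-edge `s(u, w)` with `u ∈ H`: the chains `c` and `d`
lie on the same side of `H` as the cut-edge (separated by its endpoint `u`), the chains
`a` and `b` lie on two further (distinct) sides, and `a, b, c, d` are precisely the
(maximal) chains contained in `H`. A length-0 chain denotes a side without leaves. -/
def IsFormBlob (N : LabGraph X) (H : N.G.Subgraph) (u w : N.V) (k l m n : ℕ)
    (a : Fin k → X) (b : Fin l → X) (c : Fin m → X) (d : Fin n → X) : Prop :=
  N.IsPendantBlob H ∧ N.BlobRank H 2 ∧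
  N.IsCutEdge s(u, w) ∧ ¬ N.TrivialEdge s(u, w) ∧ u ∈ H.verts ∧ w ∉ H.verts ∧
  (0 < k → N.IsMaxChainT k a) ∧ (0 < l → N.IsMaxChainT l b) ∧
  (0 < m → N.IsMaxChainT m c) ∧ (0 < n → N.IsMaxChainT n d) ∧
  Function.Injective a ∧ Function.Injective b ∧
  Function.Injective c ∧ Function.Injective d ∧
  (Set.range a ∩ Set.range b = ∅) ∧ (Set.range a ∩ Set.range c = ∅) ∧
  (Set.range a ∩ Set.range d = ∅) ∧ (Set.range b ∩ Set.range c = ∅) ∧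
  (Set.range b ∩ Set.range d = ∅) ∧ (Set.range c ∩ Set.range d = ∅) ∧
  (∀ x : X, N.LeafInBlob x H ↔
    (x ∈ Set.range a ∨ x ∈ Set.range b ∨ x ∈ Set.range c ∨ x ∈ Set.range d)) ∧
  N.ChainInBlob k a H ∧ N.ChainInBlob l b H ∧ N.ChainInBlob m c H ∧ N.ChainInBlob n d H ∧
  (∀ (i : Fin k) (j : Fin l) (p q : N.V),
    N.G.Adj (N.leaf (a i)) p → N.G.Adj (N.leaf (b j)) q → ¬ N.SameSide H p q) ∧
  (∀ (i : Fin k) (p : N.V), N.G.Adj (N.leaf (a i)) p → ¬ N.SameSide H p u) ∧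
  (∀ (j : Fin l) (q : N.V), N.G.Adj (N.leaf (b j)) q → ¬ N.SameSide H q u) ∧
  (∀ (i : Fin m) (p : N.V), N.G.Adj (N.leaf (c i)) p → N.SameSide H p u) ∧
  (∀ (j : Fin n) (q : N.V), N.G.Adj (N.leaf (d j)) q → N.SameSide H q u) ∧
  (∀ (i : Fin m) (j : Fin n) (p q : N.V),
    N.G.Adj (N.leaf (c i)) p → N.G.Adj (N.leaf (d j)) q → N.SepBy H u p q)

/-- Replace a part `S` of the network (e.g. a pendant blob together with its pendant
leaves, labelled by `A`) by a single new leaf (the `Unit` summand) attached to `w`. -/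
noncomputable def blobReplace (N : LabGraph X) (A : Set X) (S : Set N.V) (w : N.V)
    (hmem : ∀ x : X, x ∉ A → N.leaf x ∉ S) (hw : w ∉ S) :
    LabGraph ({x : X // x ∉ A} ⊕ Unit) where
  V := {v : N.V // v ∉ S} ⊕ Unit
  fV := by classical exact inferInstance
  G := SimpleGraph.fromRel (fun w₁ w₂ =>
    (∃ v₁ v₂ : {v : N.V // v ∉ S}, w₁ = Sum.inl v₁ ∧ w₂ = Sum.inl v₂ ∧ N.G.Adj v₁.1 v₂.1) ∨
    (w₁ = Sum.inl ⟨w, hw⟩ ∧ w₂ = Sum.inr ()))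
  leaf := Sum.elim (fun x => Sum.inl ⟨N.leaf x.1, hmem x.1 x.2⟩) (fun _ => Sum.inr ())

section PathLengths

variable {V : Type} [Fintype V]

open Classical in
/-- paths from `v` to `y` avoiding the set `F`. -/
noncomputable def pset (G : SimpleGraph V) (F : Set V) (v y : V) : Finset (G.Walk v y) :=
  ((Finset.univ : Finset (G.Path v y)).map ⟨Subtype.val, Subtype.val_injective⟩).filter
    (fun p => ∀ z ∈ p.support, z ∉ F)

lemma mem_pset {G : SimpleGraph V} {F : Set V} {v y : V} {p : G.Walk v y} :
    p ∈ pset G F v y ↔ p.IsPath ∧ ∀ z ∈ p.support, z ∉ F := by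
  classical
  simp [pset]

/-- lengths of the paths from `v` to `y` avoiding the set `F`. -/
noncomputable def plen (G : SimpleGraph V) (F : Set V) (v y : V) : Multiset ℕ :=
  ∑ p ∈ pset G F v y, {p.length}

lemma plen_eq_zero {G : SimpleGraph V} {F : Set V} {v y : V}
    (h : ∀ p : G.Walk v y, ∃ z ∈ p.support, z ∈ F) : plen G F v y = 0 := by
  have : pset G F v y = ∅ := by
    ext p
    simp only [mem_pset, Finset.notMem_empty, iff_false]
    rintro ⟨_, h2⟩
    obtain ⟨z, hz, hF⟩ := h p
    exact h2 z hz hF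
  simp [plen, this]

lemma plen_mem {G : SimpleGraph V} {F : Set V} {v y : V} (h : v ∈ F) : plen G F v y = 0 :=
  plen_eq_zero fun p => ⟨v, p.start_mem_support, h⟩

lemma plen_self {G : SimpleGraph V} {F : Set V} {v : V} (h : v ∉ F) : plen G F v v = {0} := by
  have : pset G F v v = {Walk.nil} := by
    ext p
    simp only [mem_pset, Finset.mem_singleton]
    constructor
    · rintro ⟨h1, _⟩
      exact Walk.eq_nil_iff_nil.2 (Walk.isPath_iff_nil.1 h1)
    · rintro rfl
      simpa using h
  simp [plen, this]

open Classical in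
lemma plen_step {G : SimpleGraph V} {F : Set V} {v y : V} (hv : v ∉ F) (hvy : v ≠ y) :
    plen G F v y =
      ∑ v' : V, if G.Adj v v' then (plen G (insert v F) v' y).map (· + 1) else 0 := by
  have key : plen G F v y = ∑ q ∈ (Finset.univ.filter fun v' => G.Adj v v').sigma
      (fun v' => pset G (insert v F) v' y), ({q.2.length + 1} : Multiset ℕ) := by
    symm
    unfold plen
    refine Finset.sum_bij (fun q hq => Walk.cons (by
      simp only [Finset.mem_sigma, Finset.mem_filter] at hq; exact hq.1.2) q.2) ?_ ?_ ?_ ?_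
    · rintro ⟨v', q⟩ hq
      simp only [Finset.mem_sigma, Finset.mem_filter, mem_pset] at hq
      obtain ⟨⟨_, ha⟩, hp, hF⟩ := hq
      rw [mem_pset, Walk.cons_isPath_iff]
      refine ⟨⟨hp, fun hm => hF v hm (Set.mem_insert _ _)⟩, ?_⟩
      intro z hz
      rw [Walk.support_cons, List.mem_cons] at hz
      rcases hz with rfl | hz
      · exact hv
      · exact fun h => hF z hz (Set.mem_insert_of_mem _ h)
    · rintro ⟨v1, q1⟩ h1 ⟨v2, q2⟩ h2 h
      simp only [Walk.cons.injEq] at h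
      obtain ⟨rfl, h⟩ := h
      simp_all
    · intro p hp
      rw [mem_pset] at hp
      cases p with
      | nil => exact absurd rfl hvy
      | cons ha q =>
        rename_i v'
        rw [Walk.cons_isPath_iff] at hp
        refine ⟨⟨v', q⟩, ?_, rfl⟩
        simp only [Finset.mem_sigma, Finset.mem_filter, mem_pset]
        refine ⟨⟨Finset.mem_univ _, ha⟩, hp.1.1, ?_⟩
        intro z hz h
        rcases h with rfl | h
        · exact hp.1.2 hz
        · exact hp.2 z (by simp [hz]) h
    · rintro ⟨v', q⟩ hq
      simp
  rw [key, Finset.sum_sigma, Finset.sum_filter]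
  refine Finset.sum_congr rfl fun v' _ => ?_
  split_ifs
  · unfold plen
    rw [← Multiset.coe_mapAddMonoidHom, map_sum]
    simp
  · rfl

lemma plen_step3 {G : SimpleGraph V} {F : Set V} {v y n1 n2 n3 : V} (hv : v ∉ F) (hvy : v ≠ y)
    (hN : G.neighborSet v = {n1, n2, n3}) (h12 : n1 ≠ n2) (h13 : n1 ≠ n3) (h23 : n2 ≠ n3) :
    plen G F v y = (plen G (insert v F) n1 y).map (· + 1) + (plen G (insert v F) n2 y).map (· + 1)
      + (plen G (insert v F) n3 y).map (· + 1) := by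
  classical
  rw [plen_step hv hvy, ← Finset.sum_filter]
  have : (Finset.univ.filter fun v' => G.Adj v v') = {n1, n2, n3} := by
    ext z
    have := Set.ext_iff.1 hN z
    simpa using this
  rw [this, Finset.sum_insert (by simp [h12, h13]), Finset.sum_insert (by simp [h23]),
    Finset.sum_singleton, add_assoc]

/-- target is a leaf whose neighbour is forbidden -/
lemma plen_dead_target {G : SimpleGraph V} {F : Set V} {v y p : V} (hvy : v ≠ y)
    (hN : ∀ z, G.Adj y z → z = p) (hp : p ∈ F) : plen G F v y = 0 := by
  apply plen_eq_zero
  intro q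
  refine ⟨p, ?_, hp⟩
  have hnn : ¬ q.Nil := Walk.not_nil_of_ne hvy
  have := hN _ (q.adj_penultimate hnn).symm
  rw [← this]
  exact q.getVert_mem_support _

/-- source is a leaf whose neighbour is forbidden -/
lemma plen_dead_source {G : SimpleGraph V} {F : Set V} {v y p : V} (hvy : v ≠ y)
    (hN : ∀ z, G.Adj v z → z = p) (hp : p ∈ F) : plen G F v y = 0 := by
  apply plen_eq_zero
  intro q
  refine ⟨p, ?_, hp⟩
  have hnn : ¬ q.Nil := Walk.not_nil_of_ne hvy
  have := hN _ (q.adj_snd hnn)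
  rw [← this]
  exact q.getVert_mem_support _

/-- leaving a set -/
lemma plen_dead_cut {G : SimpleGraph V} {F S : Set V} {v y w : V} (hv : v ∈ S) (hy : y ∉ S)
    (hN : ∀ x z, x ∈ S → z ∉ S → G.Adj x z → z = w) (hw : w ∈ F) : plen G F v y = 0 := by
  apply plen_eq_zero
  intro q
  refine ⟨w, ?_, hw⟩
  obtain ⟨d, hd, h1, h2⟩ := q.exists_boundary_dart S hv hy
  rw [← hN _ _ h1 h2 d.adj]
  exact q.dart_snd_mem_support_of_mem_darts hd

/-- traversing a side -/
lemma plen_traverse {G : SimpleGraph V} {y : V} (c ℓ : ℕ → V) (F : Set V) (m : ℕ)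
    (h0 : c 0 ∈ F) (hF : ∀ i, 1 ≤ i → i ≤ m → c i ∉ F)
    (hinj : ∀ i j, 1 ≤ i → i < j → j ≤ m → c i ≠ c j)
    (hy : ∀ i, 1 ≤ i → i ≤ m → c i ≠ y)
    (hN : ∀ i, 1 ≤ i → i ≤ m → G.neighborSet (c i) = {ℓ i, c (i - 1), c (i + 1)} ∧
      ℓ i ≠ c (i - 1) ∧ ℓ i ≠ c (i + 1) ∧ c (i - 1) ≠ c (i + 1) ∧ ℓ i ≠ y ∧
      ∀ z, G.Adj (ℓ i) z → z = c i) :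
    plen G F (c 1) y = (plen G (F ∪ c '' Set.Icc 1 m) (c (m + 1)) y).map (· + m) := by
  induction m with
  | zero => simp
  | succ m ih =>
    rw [ih (fun i h1 h2 => hF i h1 (by omega)) (fun i j h1 h2 h3 => hinj i j h1 h2 (by omega))
      (fun i h1 h2 => hy i h1 (by omega)) (fun i h1 h2 => hN i h1 (by omega))]
    obtain ⟨hn, h1, h2, h3, h4, h5⟩ := hN (m + 1) (by omega) le_rfl
    have hmem : c (m + 1) ∉ F ∪ c '' Set.Icc 1 m := by
      rintro (h | ⟨i, hi, h⟩)
      · exact hF _ (by omega) le_rfl h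
      · exact hinj i (m + 1) hi.1 (by have := hi.2; omega) le_rfl h
    rw [plen_step3 hmem (hy _ (by omega) le_rfl) hn h1 h2 h3,
      plen_dead_source h4 h5 (Set.mem_insert _ _)]
    have hprev : c (m + 1 - 1) ∈ insert (c (m + 1)) (F ∪ c '' Set.Icc 1 m) := by
      refine Set.mem_insert_of_mem _ ?_
      rcases Nat.eq_zero_or_pos m with rfl | hm
      · exact Or.inl h0
      · exact Or.inr ⟨m, ⟨hm, le_rfl⟩, rfl⟩
    rw [plen_mem hprev]
    have hset : insert (c (m + 1)) (F ∪ c '' Set.Icc 1 m) = F ∪ c '' Set.Icc 1 (m + 1) := by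
      rw [← Set.union_insert, ← Set.image_insert_eq]
      congr 2
      ext i
      simp only [Set.mem_insert_iff, Set.mem_Icc]
      omega
    rw [hset]
    simp only [Multiset.map_zero, zero_add, Multiset.map_map, Function.comp_def]
    refine Multiset.map_congr rfl fun i _ => ?_
    omega

end PathLengths

set_option linter.unusedSectionVars false

lemma dms_eq_plen (N : LabGraph X) (x y : X) :
    N.dms x y = plen N.G ∅ (N.leaf x) (N.leaf y) := by
  classical
  unfold dms plen pset
  simp only [Set.mem_empty_iff_false, not_false_eq_true, implies_true, Finset.filter_true,
    Finset.sum_map, Function.Embedding.coeFn_mk]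
  rw [Finset.sum]
  generalize (Finset.univ : Finset (N.G.Path (N.leaf x) (N.leaf y))).val = M
  induction M using Multiset.induction with
  | empty => simp
  | cons a M ih => simp [ih]

section Unique

open Polynomial

lemma multiset_four_unique (c1 c2 c3 : ℕ) (A A' : Multiset ℕ)
    (h : A + A.map (· + c1) + A.map (· + c2) + A.map (· + c3)
      = A' + A'.map (· + c1) + A'.map (· + c2) + A'.map (· + c3)) : A = A' := by
  classical
  let φ : Multiset ℕ → ℤ[X] := fun A => (A.map fun n => (X : ℤ[X]) ^ n).sum
  have hadd : ∀ A B, φ (A + B) = φ A + φ B := fun A B => by simp [φ]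
  have hmap : ∀ A c, φ (A.map (· + c)) = φ A * X ^ c := fun A c => by
    simp only [φ, Multiset.map_map, Function.comp_def, pow_add, Multiset.sum_map_mul_right]
  have hcoeff : ∀ A n, (φ A).coeff n = (A.count n : ℤ) := by
    intro A n
    induction A using Multiset.induction with
    | empty => simp [φ]
    | cons a A ih =>
      have : φ (a ::ₘ A) = X ^ a + φ A := by simp [φ]
      rw [this, coeff_add, ih, coeff_X_pow, Multiset.count_cons]
      split_ifs <;> push_cast <;> ring
  have h2 := congrArg φ h
  simp only [hadd, hmap] at h2
  have hne : (1 + X ^ c1 + X ^ c2 + X ^ c3 : ℤ[X]) ≠ 0 := by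
    intro h0
    have := congrArg (eval 1) h0
    simp at this
  have h3 : φ A * (1 + X ^ c1 + X ^ c2 + X ^ c3) = φ A' * (1 + X ^ c1 + X ^ c2 + X ^ c3) := by
    linear_combination h2
  have h4 := mul_right_cancel₀ hne h3
  ext n
  have := congrArg (fun p => coeff p n) h4
  simp only [hcoeff] at this
  exact_mod_cast this

lemma zsub_def (A : Multiset ℕ) (n : ℤ) : zsub A n = A.map (fun t : ℕ => (t : ℤ) - n) := by
  unfold zsub
  simp [Multiset.bind_def, Multiset.pure_def, Multiset.bind_singleton]

lemma toZ_def (A : Multiset ℕ) : toZ A = A.map (fun t : ℕ => (t : ℤ)) := by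
  unfold toZ
  simp [Multiset.bind_def, Multiset.pure_def, Multiset.bind_singleton]

lemma zsub_eq_iff (A B : Multiset ℕ) (m n c : ℕ) (hc : n = m + c) (h : zsub A m = zsub B n) :
    B = A.map (· + c) := by
  subst hc
  rw [zsub_def, zsub_def] at h
  have h2 := congrArg (Multiset.map (fun t : ℤ => t + (m + c))) h
  simp only [Multiset.map_map, Function.comp_def] at h2
  have hi : Function.Injective (Multiset.map (fun t : ℕ => (t : ℤ))) :=
    Multiset.map_injective Nat.cast_injective
  apply hi
  rw [Multiset.map_map]
  simp only [Function.comp_def]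
  push_cast at h2 ⊢
  simp only [sub_add_cancel] at h2
  rw [← h2]
  refine Multiset.map_congr rfl fun t _ => ?_
  ring

end Unique

section Theta

variable {V : Type} [Fintype V]

/-- The side data: a path `P 0, ..., P (k+1)` inside `B`, with inner vertices of degree three
whose third neighbour is a leaf `ℓ i` outside of `B`. -/
structure SideData (G : SimpleGraph V) (B : Set V) (k : ℕ) (P ℓ : ℕ → V) : Prop where
  mem : ∀ i, i ≤ k + 1 → P i ∈ B
  inj : ∀ i j, i < j → j ≤ k + 1 → P i ≠ P j
  nbr : ∀ i, 1 ≤ i → i ≤ k → G.neighborSet (P i) = {ℓ i, P (i - 1), P (i + 1)}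
  leafB : ∀ i, 1 ≤ i → i ≤ k → ℓ i ∉ B
  leafN : ∀ i, 1 ≤ i → i ≤ k → ∀ z, G.Adj (ℓ i) z → z = P i

lemma SideData.reverse {G : SimpleGraph V} {B : Set V} {k : ℕ} {P ℓ : ℕ → V}
    (h : SideData G B k P ℓ) :
    SideData G B k (fun i => P (k + 1 - i)) (fun i => ℓ (k + 1 - i)) where
  mem i hi := h.mem _ (by omega)
  inj i j hij hj := (h.inj _ _ (by omega) (by omega)).symm
  nbr i h1 h2 := by
    have := h.nbr (k + 1 - i) (by omega) (by omega)
    show G.neighborSet (P (k + 1 - i)) = {ℓ (k + 1 - i), P (k + 1 - (i - 1)), P (k + 1 - (i + 1))}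
    rw [this, show k + 1 - (i + 1) = k + 1 - i - 1 by omega,
      show k + 1 - (i - 1) = k + 1 - i + 1 by omega, Set.pair_comm]
  leafB i h1 h2 := h.leafB _ (by omega) (by omega)
  leafN i h1 h2 := h.leafN _ (by omega) (by omega)

lemma SideData.traverse {G : SimpleGraph V} {B : Set V} {k : ℕ} {P ℓ : ℕ → V}
    (h : SideData G B k P ℓ) {y : V} (hy : y ∉ B) (F : Set V) (m : ℕ) (hm : m ≤ k)
    (h0 : P 0 ∈ F) (hF : ∀ i, 1 ≤ i → i ≤ m → P i ∉ F)
    (hl : ∀ i, 1 ≤ i → i ≤ m → ℓ i ≠ y) :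
    plen G F (P 1) y = (plen G (F ∪ P '' Set.Icc 1 m) (P (m + 1)) y).map (· + m) := by
  apply plen_traverse (y := y) P ℓ F m h0 hF (fun i j h1 h2 h3 => h.inj i j h2 (by omega))
    (fun i h1 h2 e => hy (by rw [← e]; exact h.mem i (by omega)))
  intro i h1 h2
  refine ⟨h.nbr i h1 (by omega), ?_, ?_, h.inj _ _ (by omega) (by omega), hl i h1 h2,
    h.leafN i h1 (by omega)⟩
  · intro e
    exact h.leafB i h1 (by omega) (e ▸ h.mem _ (by omega))
  · intro e
    exact h.leafB i h1 (by omega) (e ▸ h.mem _ (by omega))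

lemma theta_plen {G : SimpleGraph V} {B F : Set V} {u w s t : V} {k l : ℕ} (hk : 1 ≤ k)
    (hl : 1 ≤ l) {P Q ℓP ℓQ : ℕ → V} (hP : SideData G B k P ℓP) (hQ : SideData G B l Q ℓQ)
    (hP0 : P 0 = s) (hPk : P (k + 1) = t) (hQ0 : Q 0 = s) (hQl : Q (l + 1) = t)
    (huB : u ∈ B) (hwB : w ∉ B)
    (hNu : G.neighborSet u = {w, s, t}) (hNs : G.neighborSet s = {P 1, Q 1, u})
    (hNt : G.neighborSet t = {P k, Q l, u})
    (hPQ : ∀ i j, 1 ≤ i → i ≤ k → 1 ≤ j → j ≤ l → P i ≠ Q j)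
    (hPu : ∀ i, i ≤ k + 1 → P i ≠ u) (hQu : ∀ i, i ≤ l + 1 → Q i ≠ u)
    (hlP : ∀ i, 2 ≤ i → i ≤ k → ℓP i ≠ ℓP 1) (hlQ : ∀ i, 1 ≤ i → i ≤ l → ℓQ i ≠ ℓP 1)
    (hF : ∀ z ∈ B, z ∉ F) (hyF : ℓP 1 ∉ F) (hwF : w ∈ F) :
    plen G F u (ℓP 1) = {3} + {l + 4} + {k + 2} + {k + l + 3} := by
  have hyB : ℓP 1 ∉ B := hP.leafB 1 le_rfl hk
  have hsB : s ∈ B := hP0 ▸ hP.mem 0 (by omega)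
  have htB : t ∈ B := hPk ▸ hP.mem (k + 1) (by omega)
  have ne_y : ∀ z ∈ B, z ≠ ℓP 1 := fun z hz e => hyB (e ▸ hz)
  have hst : s ≠ t := by rw [← hP0, ← hPk]; exact hP.inj 0 (k + 1) (by omega) le_rfl
  have hsu : s ≠ u := by rw [← hP0]; exact hPu 0 (by omega)
  have htu : t ≠ u := by rw [← hPk]; exact hPu (k + 1) (by omega)
  have hPs : ∀ i, 1 ≤ i → i ≤ k → P i ≠ s := fun i h1 h2 => by
    rw [← hP0]; exact (hP.inj 0 i (by omega) (by omega)).symm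
  have hPt : ∀ i, 1 ≤ i → i ≤ k → P i ≠ t := fun i h1 h2 => by
    rw [← hPk]; exact hP.inj i (k + 1) (by omega) (by omega)
  have hQs : ∀ i, 1 ≤ i → i ≤ l → Q i ≠ s := fun i h1 h2 => by
    rw [← hQ0]; exact (hQ.inj 0 i (by omega) (by omega)).symm
  have hQt : ∀ i, 1 ≤ i → i ≤ l → Q i ≠ t := fun i h1 h2 => by
    rw [← hQl]; exact hQ.inj i (l + 1) (by omega) (by omega)
  -- the end of the journey
  have hend : ∀ F' : Set V, P 1 ∉ F' → ℓP 1 ∉ F' → plen G F' (P 1) (ℓP 1) = {1} := by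
    intro F' h1 h2
    have hB1 := hP.mem 1 (by omega)
    rw [plen_step3 h1 (ne_y _ hB1) (hP.nbr 1 le_rfl hk)
      (ne_y _ (hP.mem _ (by omega))).symm (ne_y _ (hP.mem _ (by omega))).symm
      (hP.inj _ _ (by omega) (by omega)),
      plen_dead_target (ne_y _ (hP.mem (1 - 1) (by omega))) (hP.leafN 1 le_rfl hk)
        (Set.mem_insert _ _),
      plen_dead_target (ne_y _ (hP.mem (1 + 1) (by omega))) (hP.leafN 1 le_rfl hk)
        (Set.mem_insert _ _), plen_self]
    · rfl
    · rintro (h | h)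
      · exact ne_y _ hB1 h.symm
      · exact h2 h
  -- from t along P
  have hPback : ∀ F' : Set V, t ∈ F' → (∀ i, 1 ≤ i → i ≤ k → P i ∉ F') → ℓP 1 ∉ F' →
      plen G F' (P k) (ℓP 1) = {k} := by
    intro F' h1 h2 h3
    have := hP.reverse.traverse hyB F' (k - 1) (by omega) (by simpa [hPk] using h1)
      (fun i h4 h5 => h2 _ (by omega) (by omega)) (fun i h4 h5 => hlP _ (by omega) (by omega))
    simp only [Nat.add_sub_cancel] at this
    rw [this, show k + 1 - (k - 1 + 1) = 1 by omega, hend]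
    · simp; omega
    · rintro (h | ⟨i, hi, h⟩)
      · exact h2 1 le_rfl hk h
      · have := hi.1
        have := hi.2
        exact hP.inj 1 (k + 1 - i) (by omega) (by omega) h.symm
    · rintro (h | ⟨i, hi, h⟩)
      · exact h3 h
      · exact ne_y _ (hP.mem _ (by omega)) h


  have hvu : u ∉ F := hF u huB
  have hws : w ≠ s := fun e => hwB (e ▸ hsB)
  have hwt : w ≠ t := fun e => hwB (e ▸ htB)
  have hsF1 : s ∉ insert u F := by
    rintro (h | h)
    · exact hsu h
    · exact hF s hsB h
  have htF1 : t ∉ insert u F := by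
    rintro (h | h)
    · exact htu h
    · exact hF t htB h
  have hPF : ∀ i, 1 ≤ i → i ≤ k → P i ∉ F := fun i _ h => hF _ (hP.mem i (by omega))
  have hQF : ∀ i, 1 ≤ i → i ≤ l → Q i ∉ F := fun i _ h => hF _ (hQ.mem i (by omega))
  have hyu : ℓP 1 ≠ u := (ne_y u huB).symm
  have hys : ℓP 1 ≠ s := (ne_y s hsB).symm
  have hyt : ℓP 1 ≠ t := (ne_y t htB).symm
  have hyQ : ∀ i, 1 ≤ i → i ≤ l → Q i ≠ ℓP 1 := fun i _ h => ne_y _ (hQ.mem i (by omega))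
  -- from s
  have es : plen G (insert u F) s (ℓP 1) = {2} + {l + k + 2} := by
    rw [plen_step3 hsF1 (ne_y s hsB) hNs (hPQ 1 1 le_rfl hk le_rfl hl) (hPu 1 (by omega))
      (hQu 1 (by omega)), plen_mem (v := u) (by simp), hend]
    rotate_left
    · simp [hPs 1 le_rfl hk, hPu 1 (by omega), hPF 1 le_rfl hk]
    · simp [hys, hyu, hyF]
    rw [hQ.traverse hyB _ l le_rfl (by simp [hQ0])
      (fun i h1 h2 => by simp [hQs i h1 h2, hQu i (by omega), hQF i h1 h2])
      hlQ, hQl, plen_step3 _ (ne_y t htB) hNt (hPQ k l hk le_rfl hl le_rfl) (hPu k (by omega))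
      (hQu l (by omega)), plen_mem (v := u) (by simp),
      plen_mem (v := Q l) (by exact Or.inr (Or.inr ⟨l, ⟨hl, le_rfl⟩, rfl⟩)), hPback]
    · simp; omega
    · simp
    · intro i h1 h2
      simp only [Set.mem_insert_iff, Set.mem_union, hPt i h1 h2, hPs i h1 h2, hPu i (by omega),
        hPF i h1 h2, false_or]
      rintro ⟨j, hj, h⟩
      exact hPQ i j h1 h2 hj.1 hj.2 h.symm
    · simp only [Set.mem_insert_iff, Set.mem_union, hyt, hys, hyu, hyF, false_or]
      rintro ⟨j, hj, h⟩
      exact hyQ j hj.1 hj.2 h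
    · simp only [Set.mem_insert_iff, Set.mem_union, hst.symm, htu, hF t htB, false_or]
      rintro ⟨j, hj, h⟩
      exact hQt j hj.1 hj.2 h
  -- from t
  have et : plen G (insert u F) t (ℓP 1) = {k + 1} + {l + 3} := by
    have hb := hQ.reverse.traverse hyB (insert t (insert u F)) l le_rfl (by simp [hQl])
      (fun i h1 h2 => by simp [hQt _ (show 1 ≤ l + 1 - i by omega) (by omega), hQu _ (show l + 1 - i ≤ l + 1 by omega), hQF _ (show 1 ≤ l + 1 - i by omega) (by omega)])
      (fun i h1 h2 => hlQ _ (by omega) (by omega))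
    simp only [Nat.add_sub_cancel, Nat.sub_self] at hb
    rw [plen_step3 htF1 (ne_y t htB) hNt (hPQ k l hk le_rfl hl le_rfl) (hPu k (by omega))
      (hQu l (by omega)), plen_mem (v := u) (by simp), hPback]
    rotate_left
    · simp
    · intro i h1 h2
      simp [hPt i h1 h2, hPu i (by omega), hPF i h1 h2]
    · simp [hyt, hyu, hyF]
    rw [hb, hQ0, plen_step3 _ (ne_y s hsB) hNs (hPQ 1 1 le_rfl hk le_rfl hl) (hPu 1 (by omega))
      (hQu 1 (by omega)), plen_mem (v := u) (by simp),
      plen_mem (v := Q 1) (by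
        refine Or.inr (Or.inr ⟨l, ⟨hl, le_rfl⟩, ?_⟩)
        simp), hend]
    · simp; omega
    · simp only [Set.mem_insert_iff, Set.mem_union, hPt 1 le_rfl hk, hPs 1 le_rfl hk,
        hPu 1 (by omega), hPF 1 le_rfl hk, false_or]
      rintro ⟨j, hj, h⟩
      have h1 := hj.1
      have h2 := hj.2
      exact hPQ 1 _ le_rfl hk (by omega) (by omega) h.symm
    · simp only [Set.mem_insert_iff, Set.mem_union, hyt, hys, hyu, hyF, false_or]
      rintro ⟨j, hj, h⟩
      have h1 := hj.1
      have h2 := hj.2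
      exact hyQ _ (by omega) (by omega) h
    · simp only [Set.mem_insert_iff, Set.mem_union, hst, hsu, hF s hsB, false_or]
      rintro ⟨j, hj, h⟩
      have h1 := hj.1
      have h2 := hj.2
      exact hQs _ (by omega) (by omega) h
  rw [plen_step3 hvu (ne_y u huB) hNu hws hwt hst, es, et,
    plen_mem (v := w) (Set.mem_insert_of_mem _ hwF)]
  simp only [Multiset.map_zero, zero_add, Multiset.map_add, Multiset.map_singleton]
  rw [show 2 + 1 = 3 by rfl, show l + k + 2 + 1 = k + l + 3 by omega,
    show k + 1 + 1 = k + 2 by omega, show l + 3 + 1 = l + 4 by omega]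
  abel

end Theta

section Replace

variable {V : Type}

/-- the graph of `blobReplace`. -/
def repG (G : SimpleGraph V) (S : Set V) (w : V) (hw : w ∉ S) :
    SimpleGraph ({v : V // v ∉ S} ⊕ Unit) :=
  SimpleGraph.fromRel (fun w₁ w₂ =>
    (∃ v₁ v₂ : {v : V // v ∉ S}, w₁ = Sum.inl v₁ ∧ w₂ = Sum.inl v₂ ∧ G.Adj v₁.1 v₂.1) ∨
    (w₁ = Sum.inl ⟨w, hw⟩ ∧ w₂ = Sum.inr ()))

lemma repG_inl_inl {G : SimpleGraph V} {S : Set V} {w : V} {hw : w ∉ S} (x y : {v : V // v ∉ S}) :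
    (repG G S w hw).Adj (Sum.inl x) (Sum.inl y) ↔ G.Adj x.1 y.1 := by
  unfold repG
  rw [SimpleGraph.fromRel_adj]
  constructor
  · rintro ⟨_, (⟨v1, v2, h1, h2, h3⟩ | ⟨_, h⟩) | (⟨v1, v2, h1, h2, h3⟩ | ⟨_, h⟩)⟩
    · cases h1; cases h2; exact h3
    · cases h
    · cases h1; cases h2; exact h3.symm
    · cases h
  · intro h
    refine ⟨?_, Or.inl (Or.inl ⟨x, y, rfl, rfl, h⟩)⟩
    intro e
    cases e
    exact G.loopless.irrefl _ h

lemma repG_inl_inr {G : SimpleGraph V} {S : Set V} {w : V} {hw : w ∉ S} (x : {v : V // v ∉ S}) :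
    (repG G S w hw).Adj (Sum.inl x) (Sum.inr ()) ↔ x.1 = w := by
  unfold repG
  rw [SimpleGraph.fromRel_adj]
  constructor
  · rintro ⟨_, (⟨v1, v2, h1, h2, h3⟩ | ⟨h, _⟩) | (⟨v1, v2, h1, h2, h3⟩ | ⟨h, _⟩)⟩
    · cases h2
    · cases h; rfl
    · cases h1
    · cases h
  · intro h
    refine ⟨by simp, Or.inl (Or.inr ⟨?_, rfl⟩)⟩
    congr 1
    exact Subtype.ext h

/-- the copy of a set in the replaced graph -/
def repSet (S F : Set V) : Set ({v : V // v ∉ S} ⊕ Unit) := {z | ∃ v, z = Sum.inl v ∧ v.1 ∈ F}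

lemma repSet_inl {S F : Set V} (x : {v : V // v ∉ S}) : Sum.inl x ∈ repSet S F ↔ x.1 ∈ F := by
  constructor
  · rintro ⟨v, h, h2⟩
    cases h
    exact h2
  · intro h
    exact ⟨x, rfl, h⟩

lemma repSet_inr {S F : Set V} : (Sum.inr () : {v : V // v ∉ S} ⊕ Unit) ∉ repSet S F := by
  rintro ⟨v, h, h2⟩
  cases h

lemma repSet_insert {S F : Set V} (x : {v : V // v ∉ S}) :
    insert (Sum.inl x) (repSet S F) = repSet S (insert x.1 F) := by
  ext z
  rcases z with z | z
  · rw [repSet_inl, Set.mem_insert_iff, Set.mem_insert_iff, repSet_inl, Sum.inl.injEq,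
      Subtype.ext_iff]
  · constructor
    · rintro (h | h)
      · cases h
      · exact absurd h repSet_inr
    · intro h
      exact absurd h repSet_inr

lemma rep_plen [Fintype V] {G : SimpleGraph V} {S : Set V} {u w : V} (hw : w ∉ S)
    (hu : u ∈ S) (huw : G.Adj u w)
    (hcut : ∀ x z, x ∈ S → z ∉ S → G.Adj x z → x = u ∧ z = w)
    [inst : Fintype ({v : V // v ∉ S} ⊕ Unit)]
    (Φ : Multiset ℕ →+ Multiset ℕ) (hΦ : ∀ M, Φ (M.map (· + 1)) = (Φ M).map (· + 1))
    (y : V) (y' : {v : V // v ∉ S} ⊕ Unit)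
    (hbase : ∀ (F : Set V) (x : {v : V // v ∉ S}), x.1 ∉ F → (x.1 = y ∨ Sum.inl x = y') →
      plen G F x.1 y = Φ (plen (repG G S w hw) (repSet S F) (Sum.inl x) y'))
    (hnear : ∀ F : Set V, (∀ z ∈ F, z ∉ S) → w ∈ F →
      plen G F u y = Φ (plen (repG G S w hw) (repSet S F) (Sum.inr ()) y'))
    (F : Set V) (hF : ∀ z ∈ F, z ∉ S) (x : {v : V // v ∉ S}) :
    plen G F x.1 y = Φ (plen (repG G S w hw) (repSet S F) (Sum.inl x) y') := by
  classical
  obtain rfl : inst = instFintypeSum _ _ := Subsingleton.elim _ _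
  generalize hn : (Fᶜ).ncard = n
  induction n using Nat.strong_induction_on generalizing F x with
  | _ n ih =>
    by_cases hxF : x.1 ∈ F
    · rw [plen_mem hxF, plen_mem ((repSet_inl x).2 hxF), map_zero]
    by_cases hxy : x.1 = y ∨ Sum.inl x = y'
    · exact hbase F x hxF hxy
    push Not at hxy
    have hF' : ∀ z ∈ insert x.1 F, z ∉ S := by
      rintro z (rfl | h)
      · exact x.2
      · exact hF z h
    have hlt : ((insert x.1 F)ᶜ).ncard < n := by
      rw [← hn]
      apply Set.ncard_lt_ncard _ (Set.toFinite _)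
      refine ⟨Set.compl_subset_compl.2 (Set.subset_insert _ _), fun h => ?_⟩
      exact h hxF (Set.mem_insert _ _)
    rw [plen_step hxF hxy.1, plen_step (fun h => hxF ((repSet_inl x).1 h)) hxy.2,
      Fintype.sum_sum_type, map_add, map_sum,
      ← Fintype.sum_subtype_add_sum_subtype (fun v => v ∉ S)]
    congr 1
    · refine Finset.sum_congr rfl fun v _ => ?_
      rw [repSet_insert]
      by_cases h : G.Adj x.1 v.1
      · rw [if_pos h, if_pos ((repG_inl_inl _ _).2 h), hΦ, ih _ hlt _ hF' v rfl]
      · rw [if_neg h, if_neg (fun h2 => h ((repG_inl_inl _ _).1 h2)), map_zero]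
    · rw [repSet_insert]
      simp only [Finset.univ_unique, Finset.sum_singleton]
      rw [show (default : Unit) = () from rfl]
      by_cases h : x.1 = w
      · rw [if_pos ((repG_inl_inr _).2 h), hΦ, ← hnear _ hF' (by simp [h]),
          Finset.sum_eq_single ⟨u, by simpa using hu⟩]
        · rw [if_pos (h ▸ huw.symm)]
        · rintro ⟨v, hv⟩ _ hne
          rw [if_neg]
          intro ha
          apply hne
          exact Subtype.ext (hcut v x.1 (by simpa using hv) x.2 ha.symm).1
        · simp
      · rw [if_neg (fun h2 => h ((repG_inl_inr _).1 h2)), map_zero]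
        refine Finset.sum_eq_zero ?_
        rintro ⟨v, hv⟩ _
        rw [if_neg]
        intro ha
        exact h (hcut v x.1 (by simpa using hv) x.2 ha.symm).2

open Classical in
/-- contraction map -/
noncomputable def repMap (S : Set V) (v : V) : {v : V // v ∉ S} ⊕ Unit :=
  if h : v ∈ S then Sum.inr () else Sum.inl ⟨v, h⟩

lemma repMap_mem {S : Set V} {v : V} (h : v ∈ S) : repMap S v = Sum.inr () := by
  simp [repMap, h]

lemma repMap_notMem {S : Set V} {v : V} (h : v ∉ S) : repMap S v = Sum.inl ⟨v, h⟩ := by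
  simp [repMap, h]

lemma repG_connected {G : SimpleGraph V} {S : Set V} {u w : V} (hw : w ∉ S) (hu : u ∈ S)
    (hcut : ∀ x z, x ∈ S → z ∉ S → G.Adj x z → x = u ∧ z = w) (hG : G.Connected) :
    (repG G S w hw).Connected := by
  have hadj : ∀ x y, G.Adj x y → (repG G S w hw).Reachable (repMap S x) (repMap S y) := by
    intro x y h
    by_cases hx : x ∈ S <;> by_cases hy : y ∈ S
    · rw [repMap_mem hx, repMap_mem hy]
    · rw [repMap_mem hx, repMap_notMem hy]
      exact ((repG_inl_inr _).2 (hcut x y hx hy h).2).symm.reachable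
    · rw [repMap_mem hy, repMap_notMem hx]
      exact ((repG_inl_inr _).2 (hcut y x hy hx h.symm).2).reachable
    · rw [repMap_notMem hx, repMap_notMem hy]
      exact ((repG_inl_inl _ _).2 h).reachable
  have hwalk : ∀ x y, G.Walk x y → (repG G S w hw).Reachable (repMap S x) (repMap S y) := by
    intro x y p
    induction p with
    | nil => rfl
    | cons h p ih => exact (hadj _ _ h).trans ih
  have hsurj : ∀ z, ∃ x, repMap S x = z := by
    rintro (z | z)
    · exact ⟨z.1, repMap_notMem z.2⟩
    · exact ⟨u, repMap_mem hu⟩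
  have : Nonempty ({v : V // v ∉ S} ⊕ Unit) := ⟨Sum.inr ()⟩
  refine SimpleGraph.Connected.mk ?_
  intro a b
  obtain ⟨x, rfl⟩ := hsurj a
  obtain ⟨y, rfl⟩ := hsurj b
  obtain ⟨p⟩ := hG.preconnected x y
  exact hwalk x y p

lemma repG_deg_inl {G : SimpleGraph V} {S : Set V} {u w : V} (hw : w ∉ S) (hu : u ∈ S)
    (huw : G.Adj u w)
    (hcut : ∀ x z, x ∈ S → z ∉ S → G.Adj x z → x = u ∧ z = w) (x : {v : V // v ∉ S}) :
    ((repG G S w hw).neighborSet (Sum.inl x)).ncard = (G.neighborSet x.1).ncard := by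
  have : (repG G S w hw).neighborSet (Sum.inl x) = repMap S '' (G.neighborSet x.1) := by
    ext z
    rw [SimpleGraph.mem_neighborSet]
    rcases z with z | z
    · rw [repG_inl_inl]
      constructor
      · intro h
        exact ⟨z.1, h, repMap_notMem z.2⟩
      · rintro ⟨v, hv, h⟩
        by_cases hvS : v ∈ S
        · rw [repMap_mem hvS] at h; cases h
        · rw [repMap_notMem hvS] at h
          cases h
          exact hv
    · rw [show z = () from rfl, repG_inl_inr]
      constructor
      · intro h
        exact ⟨u, by rw [h]; exact huw.symm, repMap_mem hu⟩
      · rintro ⟨v, hv, h⟩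
        by_cases hvS : v ∈ S
        · exact (hcut v x.1 hvS x.2 (SimpleGraph.Adj.symm hv)).2
        · rw [repMap_notMem hvS] at h; cases h
  rw [this, Set.InjOn.ncard_image]
  intro v1 h1 v2 h2 h
  by_cases hv1 : v1 ∈ S <;> by_cases hv2 : v2 ∈ S
  · rw [(hcut v1 x.1 hv1 x.2 (SimpleGraph.Adj.symm h1)).1,
      (hcut v2 x.1 hv2 x.2 (SimpleGraph.Adj.symm h2)).1]
  · rw [repMap_mem hv1, repMap_notMem hv2] at h; cases h
  · rw [repMap_mem hv2, repMap_notMem hv1] at h; cases h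
  · rw [repMap_notMem hv1, repMap_notMem hv2] at h
    cases h
    rfl

lemma repG_deg_inr {G : SimpleGraph V} {S : Set V} {w : V} (hw : w ∉ S) :
    ((repG G S w hw).neighborSet (Sum.inr ())).ncard = 1 := by
  rw [Set.ncard_eq_one]
  refine ⟨Sum.inl ⟨w, hw⟩, ?_⟩
  ext z
  rw [SimpleGraph.mem_neighborSet, SimpleGraph.adj_comm]
  rcases z with z | z
  · rw [repG_inl_inr]
    simp [Subtype.ext_iff]
  · simp

end Replace

lemma blobReplace_isNetwork (N : LabGraph X) (A : Set X) (S : Set N.V) (u w : N.V)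
    (hmem : ∀ x : X, x ∉ A → N.leaf x ∉ S) (hw : w ∉ S) (hA : ∀ x ∈ A, N.leaf x ∈ S)
    (hu : u ∈ S) (huw : N.G.Adj u w)
    (hcut : ∀ x z, x ∈ S → z ∉ S → N.G.Adj x z → x = u ∧ z = w) [Fintype ({x : X // x ∉ A} ⊕ Unit)]
    (hconn : N.G.Connected) (hinj : Function.Injective N.leaf)
    (hdeg1 : ∀ x : X, N.degOf (N.leaf x) = 1)
    (hdeg3 : ∀ v : N.V, v ∉ Set.range N.leaf → N.degOf v = 3) :
    (N.blobReplace A S w hmem hw).IsNetwork := by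
  refine ⟨repG_connected hw hu hcut hconn, ?_, Or.inr ⟨?_, ?_⟩⟩
  · rintro (x | x) (y | y) h
    · have h2 : (⟨N.leaf x.1, hmem x.1 x.2⟩ : {v : N.V // v ∉ S}) = ⟨N.leaf y.1, hmem y.1 y.2⟩ :=
        Sum.inl.inj h
      have := hinj (congrArg Subtype.val h2)
      rw [Subtype.ext this]
    · cases h
    · cases h
    · rfl
  · rintro (x | x)
    · exact (repG_deg_inl hw hu huw hcut ⟨N.leaf x.1, hmem x.1 x.2⟩).trans (hdeg1 x.1)
    · exact repG_deg_inr hw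
  · rintro (v | v) hv
    · refine (repG_deg_inl hw hu huw hcut v).trans (hdeg3 v.1 ?_)
      rintro ⟨x, hx⟩
      apply hv
      have hxA : x ∉ A := fun h => v.2 (hx ▸ hA x h)
      refine ⟨Sum.inl ⟨x, hxA⟩, ?_⟩
      exact congrArg Sum.inl (Subtype.ext hx)
    · exact absurd ⟨Sum.inr (), rfl⟩ hv

section Blob

lemma exit_lemma {N : LabGraph X} {H : N.G.Subgraph} (h : N.TwoConnSub H) {t c d : N.V}
    (ht : t ∈ H.verts) {C : Set N.V} (hc : c ∈ H.verts) (hcC : c ∈ C) (hct : c ≠ t)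
    (hd : d ∈ H.verts) (hdC : d ∉ C) (hdt : d ≠ t) :
    ∃ x ∈ C, ∃ y, y ∉ C ∧ H.Adj x y ∧ x ≠ t ∧ y ≠ t := by
  have hcon := h.2.2 t ht
  obtain ⟨p⟩ := hcon.preconnected ⟨c, by simp [hc, hct]⟩ ⟨d, by simp [hd, hdt]⟩
  obtain ⟨e, _, h1, h2⟩ := p.exists_boundary_dart {z | z.1 ∈ C} hcC hdC
  have ha := e.adj
  rw [Subgraph.coe_adj, Subgraph.deleteVerts_adj] at ha
  exact ⟨e.fst.1, h1, e.snd.1, h2, ha.2.2.2.2, ha.2.1, ha.2.2.2.1⟩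

lemma third_vertex {N : LabGraph X} {H : N.G.Subgraph} (h : N.TwoConnSub H) (v y : N.V) :
    ∃ d ∈ H.verts, d ≠ v ∧ d ≠ y := by
  have h1 : ({v, y} : Set N.V).ncard < H.verts.ncard :=
    lt_of_le_of_lt (Set.ncard_insert_le _ _) (by rw [Set.ncard_singleton]; have := h.1; omega)
  obtain ⟨d, hd, hd2⟩ := Set.exists_mem_notMem_of_ncard_lt_ncard h1
  simp only [Set.mem_insert_iff, Set.mem_singleton_iff, not_or] at hd2
  exact ⟨d, hd, hd2⟩

lemma two_nbrs {N : LabGraph X} {H : N.G.Subgraph} (h : N.TwoConnSub H) {v : N.V}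
    (hv : v ∈ H.verts) : ∃ y1 y2, y1 ≠ y2 ∧ H.Adj v y1 ∧ H.Adj v y2 := by
  obtain ⟨t, ht, htv, _⟩ := third_vertex h v v
  obtain ⟨d, hd, hdv, hdt⟩ := third_vertex h v t
  obtain ⟨x, hx, y1, hy1, ha, _, _⟩ := exit_lemma h ht (C := {v}) hv rfl htv.symm hd hdv hdt
  rw [Set.mem_singleton_iff] at hx
  subst hx
  obtain ⟨d, hd, hdv, hdt⟩ := third_vertex h x y1
  obtain ⟨x', hx, y2, hy2, ha2, _, h2⟩ := exit_lemma h ha.snd_mem (C := {x}) hv rfl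
    ha.adj_sub.ne hd hdv hdt
  rw [Set.mem_singleton_iff] at hx
  subst hx
  exact ⟨y1, y2, h2.symm, ha, ha2⟩

lemma ear {N : LabGraph X} {H : N.G.Subgraph} (h : N.IsBlob H) {v z : N.V} (hv : v ∈ H.verts)
    (hz : z ∈ H.verts) (hvz : v ≠ z) (p : N.G.Walk v z) (hp : p.IsPath) :
    (⊤ : N.G.Subgraph).induce (H.verts ∪ {x | x ∈ p.support}) = H := by
  classical
  set W : Set N.V := H.verts ∪ {x | x ∈ p.support} with hW
  set H' := (⊤ : N.G.Subgraph).induce W with hH'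
  have hle : H ≤ H' := by
    refine ⟨Set.subset_union_left, ?_⟩
    intro x y ha
    simp only [hH', Subgraph.induce_adj, Subgraph.top_adj]
    exact ⟨Or.inl ha.fst_mem, Or.inl ha.snd_mem, ha.adj_sub⟩
  have hpW : p.toSubgraph ≤ H' :=
    p.toSubgraph_le_induce_support.trans (Subgraph.induce_mono_right Set.subset_union_right)
  have hHc : H.Connected := ⟨h.1.2.1⟩
  refine h.2 H' ⟨?_, ?_, ?_⟩ hle
  · exact h.1.1.trans (Set.ncard_le_ncard hle.1 (Set.toFinite _))
  · have hc : (H ⊔ p.toSubgraph).Connected := by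
      refine Subgraph.connected_sup hHc.preconnected p.toSubgraph_connected.preconnected ?_
      exact ⟨v, hv, by simp⟩
    refine (Subgraph.Connected.mono (sup_le hle hpW) ?_ hc).coe
    ext x
    simp [hH', hW]
  · intro x hx
    have hmono : ∀ {y y' : N.V} (q : N.G.Walk y y'), (∀ r ∈ q.support, r ∈ W ∧ r ≠ x) →
        q.toSubgraph ≤ H'.deleteVerts {x} := by
      intro y y' q hq
      refine q.toSubgraph_le_induce_support.trans ?_
      refine ⟨fun r hr => ⟨(hq r hr).1, (hq r hr).2⟩, ?_⟩
      intro r r' hr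
      simp only [Subgraph.induce_adj, Subgraph.top_adj, Set.mem_ofPred_eq] at hr
      simp only [hH', Subgraph.induce_adj, Subgraph.top_adj,
        Subgraph.induce_verts]
      exact ⟨⟨(hq r hr.1).1, (hq r hr.1).2⟩, ⟨(hq r' hr.2.1).1, (hq r' hr.2.1).2⟩,
        (hq r hr.1).1, (hq r' hr.2.1).1, hr.2.2⟩
    obtain ⟨K, hK, hKc, hKv⟩ : ∃ K : N.G.Subgraph, K ≤ H'.deleteVerts {x} ∧ K.Connected ∧
        K.verts = H.verts \ {x} := by
      refine ⟨H.deleteVerts {x}, ?_, ?_, by simp⟩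
      · exact Subgraph.deleteVerts_mono hle
      · by_cases hxH : x ∈ H.verts
        · exact ⟨h.1.2.2 x hxH⟩
        · have : H.deleteVerts {x} = H := by
            rw [Subgraph.deleteVerts, Set.sdiff_singleton_eq_self hxH, Subgraph.induce_self_verts]
          rw [this]
          exact hHc
    have hreach : ∀ y ∈ (H'.deleteVerts {x}).verts, ∃ r ∈ K.verts, ∃ q : N.G.Walk y r,
        q.toSubgraph ≤ H'.deleteVerts {x} := by
      rintro y ⟨hy, hyx⟩
      rw [Set.mem_singleton_iff] at hyx
      rcases hy with hy | hy
      · refine ⟨y, by rw [hKv]; exact ⟨hy, hyx⟩, Walk.nil, hmono _ ?_⟩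
        intro r hr
        simp only [Walk.support_nil, List.mem_singleton] at hr
        subst hr
        exact ⟨Or.inl hy, hyx⟩
      · have hy : y ∈ p.support := hy
        by_cases hxt : x ∈ (p.takeUntil y hy).support
        · have hxd : x ∉ (p.dropUntil y hy).support := by
            intro hxd
            have hnd := hp.support_nodup
            rw [← p.take_spec hy, Walk.support_append, List.nodup_append] at hnd
            have htail : x ∈ (p.dropUntil y hy).support.tail := by
              rw [Walk.mem_support_iff] at hxd
              rcases hxd with hxd | hxd
              · exact absurd hxd.symm hyx
              · exact hxd
            exact hnd.2.2 x hxt x htail rfl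
          refine ⟨z, ?_, p.dropUntil y hy, hmono _ ?_⟩
          · rw [hKv]
            refine ⟨hz, ?_⟩
            rintro rfl
            exact hxd (Walk.end_mem_support _)
          · intro r hr
            refine ⟨Or.inr (p.support_dropUntil_subset_support hy hr), ?_⟩
            rintro rfl
            exact hxd hr
        · refine ⟨v, ?_, (p.takeUntil y hy).reverse, hmono _ ?_⟩
          · rw [hKv]
            refine ⟨hv, ?_⟩
            rintro rfl
            exact hxt (Walk.start_mem_support _)
          · intro r hr
            rw [Walk.support_reverse, List.mem_reverse] at hr
            refine ⟨Or.inr (p.support_takeUntil_subset_support hy hr), ?_⟩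
            rintro rfl
            exact hxt hr
    refine Subgraph.Connected.coe ?_
    rw [Subgraph.connected_iff_forall_exists_walk_subgraph]
    refine ⟨?_, ?_⟩
    · obtain ⟨r, hr⟩ := hKc.nonempty
      exact ⟨r, hK.1 hr⟩
    · intro y y' hy hy'
      obtain ⟨r, hr, q, hq⟩ := hreach y hy
      obtain ⟨r', hr', q', hq'⟩ := hreach y' hy'
      obtain ⟨m, hm⟩ := ((Subgraph.connected_iff_forall_exists_walk_subgraph K).1 hKc).2 hr hr'
      refine ⟨(q.append m).append q'.reverse, ?_⟩
      rw [Walk.toSubgraph_append, Walk.toSubgraph_append, Walk.toSubgraph_reverse]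
      exact sup_le (sup_le hq (hm.trans hK)) hq'

lemma ear_support {N : LabGraph X} {H : N.G.Subgraph} (h : N.IsBlob H) {v z : N.V}
    (hv : v ∈ H.verts) (hz : z ∈ H.verts) (hvz : v ≠ z) (p : N.G.Walk v z) (hp : p.IsPath) :
    ∀ x ∈ p.support, x ∈ H.verts := by
  intro x hx
  have := congrArg Subgraph.verts (ear h hv hz hvz p hp)
  rw [← this]
  exact Or.inr hx

lemma blob_adj {N : LabGraph X} {H : N.G.Subgraph} (h : N.IsBlob H) {v z : N.V}
    (hv : v ∈ H.verts) (hz : z ∈ H.verts) (ha : N.G.Adj v z) : H.Adj v z := by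
  have := ear h hv hz ha.ne (Walk.cons ha Walk.nil) (by simp [ha.ne])
  rw [← this]
  simp only [Subgraph.induce_adj, Subgraph.top_adj]
  exact ⟨Or.inl hv, Or.inl hz, ha⟩

lemma set_eq_three {α : Type} [Finite α] {s : Set α} {x y z : α} (hs : s.ncard = 3)
    (hx : x ∈ s) (hy : y ∈ s) (hz : z ∈ s) (hxy : x ≠ y) (hxz : x ≠ z) (hyz : y ≠ z) :
    s = {x, y, z} := by
  symm
  apply Set.eq_of_subset_of_ncard_le
  · rintro r (rfl | rfl | rfl) <;> assumption
  · rw [hs, Set.ncard_eq_three.2 ⟨x, y, z, hxy, hxz, hyz, rfl⟩]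
  · exact Set.toFinite _

lemma blob_not_leaf {N : LabGraph X} {H : N.G.Subgraph} (h : N.IsBlob H)
    (hdeg1 : ∀ x : X, N.degOf (N.leaf x) = 1) {v : N.V} (hv : v ∈ H.verts) :
    v ∉ Set.range N.leaf := by
  rintro ⟨x, rfl⟩
  obtain ⟨y1, y2, hne, h1, h2⟩ := two_nbrs h.1 hv
  have := hdeg1 x
  unfold degOf at this
  rw [Set.ncard_eq_one] at this
  obtain ⟨r, hr⟩ := this
  have e1 : y1 ∈ N.G.neighborSet (N.leaf x) := h1.adj_sub
  have e2 : y2 ∈ N.G.neighborSet (N.leaf x) := h2.adj_sub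
  rw [hr] at e1 e2
  exact hne (e1.trans e2.symm)

/-- a blob vertex with an outside neighbour has exactly two neighbours in the blob -/
lemma blob_outer {N : LabGraph X} {H : N.G.Subgraph} (h : N.IsBlob H)
    (hdeg1 : ∀ x : X, N.degOf (N.leaf x) = 1)
    (hdeg3 : ∀ v : N.V, v ∉ Set.range N.leaf → N.degOf v = 3) {v v' : N.V} (hv : v ∈ H.verts)
    (hv' : v' ∉ H.verts) (ha : N.G.Adj v v') :
    ∃ y1 y2, y1 ≠ y2 ∧ H.Adj v y1 ∧ H.Adj v y2 ∧ N.G.neighborSet v = {v', y1, y2} := by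
  obtain ⟨y1, y2, hne, h1, h2⟩ := two_nbrs h.1 hv
  refine ⟨y1, y2, hne, h1, h2, ?_⟩
  apply set_eq_three (hdeg3 v (blob_not_leaf h hdeg1 hv)) ha h1.adj_sub h2.adj_sub _ _ hne
  · rintro rfl
    exact hv' h1.snd_mem
  · rintro rfl
    exact hv' h2.snd_mem

lemma blob_outer_deg {N : LabGraph X} {H : N.G.Subgraph} (h : N.IsBlob H)
    (hdeg1 : ∀ x : X, N.degOf (N.leaf x) = 1)
    (hdeg3 : ∀ v : N.V, v ∉ Set.range N.leaf → N.degOf v = 3) {v v' : N.V} (hv : v ∈ H.verts)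
    (hv' : v' ∉ H.verts) (ha : N.G.Adj v v') : (H.neighborSet v).ncard ≤ 2 := by
  obtain ⟨y1, y2, hne, h1, h2, h3⟩ := blob_outer h hdeg1 hdeg3 hv hv' ha
  have hsub : H.neighborSet v ⊆ {y1, y2} := by
    intro z hz
    have : z ∈ N.G.neighborSet v := Subgraph.Adj.adj_sub hz
    rw [h3] at this
    rcases this with rfl | h
    · exact absurd (Subgraph.Adj.snd_mem hz) hv'
    · exact h
  exact (Set.ncard_le_ncard hsub (Set.toFinite _)).trans (by rw [Set.ncard_pair hne])

lemma blob_outer_cut {N : LabGraph X} {H : N.G.Subgraph} (h : N.IsBlob H)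
    (hdeg1 : ∀ x : X, N.degOf (N.leaf x) = 1)
    (hdeg3 : ∀ v : N.V, v ∉ Set.range N.leaf → N.degOf v = 3) {v v' : N.V} (hv : v ∈ H.verts)
    (hv' : v' ∉ H.verts) (ha : N.G.Adj v v') : N.IsCutEdge s(v, v') := by
  classical
  refine ⟨ha, fun hcon => ?_⟩
  obtain ⟨y1, y2, hne, h1, h2, h3⟩ := blob_outer h hdeg1 hdeg3 hv hv' ha
  obtain ⟨p0⟩ := hcon.preconnected v v'
  have hp := p0.toPath.2
  generalize (p0.toPath : (N.G.deleteEdges {s(v, v')}).Walk v v') = p at hp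
  cases p with
  | nil => exact N.G.loopless.irrefl _ ha
  | cons hadj q =>
    rename_i y
    rw [Walk.cons_isPath_iff] at hp
    rw [deleteEdges_adj] at hadj
    have hyv' : y ≠ v' := by
      rintro rfl
      exact hadj.2 rfl
    have hy : y ∈ H.verts := by
      have : y ∈ N.G.neighborSet v := hadj.1
      rw [h3] at this
      rcases this with h | rfl | rfl
      · exact absurd h hyv'
      · exact h1.snd_mem
      · exact h2.snd_mem
    have hle : N.G.deleteEdges {s(v, v')} ≤ N.G := deleteEdges_le _
    have hpath : (Walk.cons ha (q.mapLe hle).reverse).IsPath := by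
      rw [Walk.cons_isPath_iff]
      refine ⟨((Walk.isPath_mapLe hle).2 hp.1).reverse, ?_⟩
      simpa using hp.2
    exact hv' (ear_support h hv hy hadj.1.ne _ hpath v' (by simp))

/-- the number of branch vertices -/
lemma branch_two {N : LabGraph X} {H : N.G.Subgraph} (h : N.IsBlob H)
    (hdeg1 : ∀ x : X, N.degOf (N.leaf x) = 1)
    (hdeg3 : ∀ v : N.V, v ∉ Set.range N.leaf → N.degOf v = 3) (hr : N.BlobRank H 2) :
    (N.branchVerts H).ncard = 2 := by
  classical
  have hdeg : ∀ v, H.spanningCoe.degree v =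
      (if v ∈ H.verts then 2 else 0) + (if v ∈ N.branchVerts H then 1 else 0) := by
    intro v
    have e : H.spanningCoe.degree v = (H.neighborSet v).ncard := by
      rw [← SimpleGraph.card_neighborFinset_eq_degree, ← Set.ncard_coe_finset]
      congr 1
      ext z
      simp
    rw [e]
    by_cases hv : v ∈ H.verts
    · have hge : 2 ≤ (H.neighborSet v).ncard := by
        obtain ⟨y1, y2, hne, h1, h2⟩ := two_nbrs h.1 hv
        rw [← Set.ncard_pair hne]
        apply Set.ncard_le_ncard _ (Set.toFinite _)
        rintro z (rfl | rfl)
        · exact h1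
        · exact h2
      have hle : (H.neighborSet v).ncard ≤ 3 := by
        rw [← hdeg3 v (blob_not_leaf h hdeg1 hv)]
        exact Set.ncard_le_ncard (H.neighborSet_subset v) (Set.toFinite _)
      by_cases hb : v ∈ N.branchVerts H
      · rw [if_pos hv, if_pos hb]
        have := hb.2
        omega
      · rw [if_pos hv, if_neg hb]
        have : ¬ 3 ≤ (H.neighborSet v).ncard := fun h3 => hb ⟨hv, h3⟩
        omega
    · have hb : v ∉ N.branchVerts H := fun hb => hv hb.1
      rw [if_neg hv, if_neg hb, Set.ncard_eq_zero (Set.toFinite _)]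
      ext z
      simp only [Subgraph.mem_neighborSet, Set.mem_empty_iff_false, iff_false]
      exact fun ha => hv ha.fst_mem
  have hsum := H.spanningCoe.sum_degrees_eq_twice_card_edges
  simp only [hdeg] at hsum
  rw [Finset.sum_add_distrib, ← Finset.sum_filter, ← Finset.sum_filter, Finset.sum_const,
    Finset.sum_const] at hsum
  have e1 : (Finset.univ.filter fun v => v ∈ H.verts).card = H.verts.ncard := by
    rw [← Set.ncard_coe_finset]
    congr 1
    ext z
    simp
  have e2 : (Finset.univ.filter fun v => v ∈ N.branchVerts H).card = (N.branchVerts H).ncard := by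
    rw [← Set.ncard_coe_finset]
    congr 1
    ext z
    simp
  have e3 : H.spanningCoe.edgeFinset.card = H.edgeSet.ncard := by
    rw [← Set.ncard_coe_finset]
    congr 1
    rw [SimpleGraph.coe_edgeFinset, Subgraph.edgeSet_spanningCoe]
  rw [e1, e2, e3] at hsum
  unfold BlobRank at hr
  simp only [smul_eq_mul] at hsum
  omega

lemma sameSide_of_adj {N : LabGraph X} {H : N.G.Subgraph} {p q : N.V} (ha : H.Adj p q)
    (hp : p ∉ N.branchVerts H) (hq : q ∉ N.branchVerts H) : N.SameSide H p q := by
  refine ⟨⟨ha.fst_mem, hp⟩, ⟨ha.snd_mem, hq⟩, SimpleGraph.Adj.reachable ?_⟩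
  rw [Subgraph.coe_adj, Subgraph.deleteVerts_adj]
  exact ⟨ha.fst_mem, hp, ha.snd_mem, hq, ha⟩

end Blob

section Sides

lemma side_ends {N : LabGraph X} {H : N.G.Subgraph} (h : N.TwoConnSub H) {s t d : N.V}
    (hs : s ∈ H.verts) (ht : t ∈ H.verts) (hst : s ≠ t) (hd : d ∈ H.verts) (hds : d ≠ s)
    (hdt : d ≠ t) (k : ℕ) (hk : 1 ≤ k) (p : ℕ → N.V) (hp : ∀ i < k, p i ∈ H.verts)
    (hps : ∀ i < k, p i ≠ s) (hpt : ∀ i < k, p i ≠ t) (hpd : ∀ i < k, p i ≠ d)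
    (hinj : ∀ i j, i < j → j < k → p i ≠ p j)
    (hadj : ∀ i, i + 1 < k → H.Adj (p i) (p (i + 1)))
    (hclosed : ∀ i < k, ∀ z, H.Adj (p i) z → z = s ∨ z = t ∨ ∃ j < k, z = p j)
    (hdeg : ∀ i < k, (H.neighborSet (p i)).ncard ≤ 2) :
    (H.Adj s (p 0) ∧ H.Adj (p (k - 1)) t) ∨ (H.Adj t (p 0) ∧ H.Adj (p (k - 1)) s) := by
  have hthree : ∀ i < k, ∀ x y z, H.Adj (p i) x → H.Adj (p i) y → H.Adj (p i) z →
      x ≠ y → x ≠ z → y ≠ z → False := by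
    intro i hi x y z hx hy hz hxy hxz hyz
    have h1 : ({x, y, z} : Set N.V) ⊆ H.neighborSet (p i) := by
      rintro r (rfl | rfl | rfl) <;> assumption
    have h2 := Set.ncard_le_ncard h1 (Set.toFinite _)
    rw [Set.ncard_eq_three.2 ⟨x, y, z, hxy, hxz, hyz, rfl⟩] at h2
    have := hdeg i hi
    omega
  have hdC : d ∉ {z | ∃ i < k, z = p i} := by
    rintro ⟨i, hi, e⟩
    exact hpd i hi e.symm
  obtain ⟨i, hi, his⟩ : ∃ i < k, H.Adj (p i) s := by
    obtain ⟨x, ⟨i, hi, rfl⟩, y, hy, ha, _, hyt⟩ := exit_lemma h ht (C := {z | ∃ i < k, z = p i})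
      (hp 0 hk) ⟨0, hk, rfl⟩ (hpt 0 hk) hd hdC hdt
    rcases hclosed i hi y ha with rfl | rfl | hj
    · exact ⟨i, hi, ha⟩
    · exact absurd rfl hyt
    · exact absurd hj hy
  obtain ⟨j, hj, hjt⟩ : ∃ i < k, H.Adj (p i) t := by
    obtain ⟨x, ⟨i, hi, rfl⟩, y, hy, ha, _, hyt⟩ := exit_lemma h hs (C := {z | ∃ i < k, z = p i})
      (hp 0 hk) ⟨0, hk, rfl⟩ (hps 0 hk) hd hdC hds
    rcases hclosed i hi y ha with rfl | rfl | hj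
    · exact absurd rfl hyt
    · exact ⟨i, hi, ha⟩
    · exact absurd hj hy
  have hend : ∀ i < k, ∀ r, (∀ i < k, p i ≠ r) → H.Adj (p i) r → i = 0 ∨ i = k - 1 := by
    intro i hi r hr ha
    by_contra hcon
    have h1 := (hadj (i - 1) (by omega)).symm
    rw [show i - 1 + 1 = i by omega] at h1
    exact hthree i hi _ _ _ h1 (hadj i (by omega)) ha (hinj _ _ (by omega) (by omega))
      (hr _ (by omega)) (hr _ (by omega))
  by_cases hk1 : k = 1
  · subst hk1
    have hi0 : i = 0 := by omega
    have hj0 : j = 0 := by omega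
    subst hi0 hj0
    exact Or.inl ⟨his.symm, hjt⟩
  have hij : i ≠ j := by
    rintro rfl
    rcases hend i hi s hps his with rfl | rfl
    · exact hthree 0 hi _ _ _ (hadj 0 (by omega)) his hjt (hps _ (by omega)) (hpt _ (by omega)) hst
    · have h1 := (hadj (k - 1 - 1) (by omega)).symm
      rw [show k - 1 - 1 + 1 = k - 1 by omega] at h1
      exact hthree _ hi _ _ _ h1 his hjt (hps _ (by omega)) (hpt _ (by omega)) hst
  rcases hend i hi s hps his with rfl | rfl
  · rcases hend j hj t hpt hjt with rfl | rfl
    · exact absurd rfl hij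
    · exact Or.inl ⟨his.symm, hjt⟩
  · rcases hend j hj t hpt hjt with rfl | rfl
    · exact Or.inr ⟨hjt.symm, his⟩
    · exact absurd rfl hij

lemma mk_side {N : LabGraph X} {H : N.G.Subgraph} {s t : N.V}
    (hs : s ∈ H.verts) (ht : t ∈ H.verts) (hst : s ≠ t) (k : ℕ) (hk : 1 ≤ k) (p ℓ : ℕ → N.V)
    (hp : ∀ i < k, p i ∈ H.verts)
    (hps : ∀ i < k, p i ≠ s) (hpt : ∀ i < k, p i ≠ t)
    (hinj : ∀ i j, i < j → j < k → p i ≠ p j)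
    (hadj : ∀ i, i + 1 < k → H.Adj (p i) (p (i + 1)))
    (hdeg : ∀ i < k, (N.G.neighborSet (p i)).ncard = 3)
    (hl : ∀ i < k, ℓ i ∉ H.verts) (hla : ∀ i < k, N.G.Adj (ℓ i) (p i))
    (hln : ∀ i < k, ∀ z, N.G.Adj (ℓ i) z → z = p i)
    (h0 : H.Adj s (p 0)) (h1 : H.Adj (p (k - 1)) t) :
    ∃ P : ℕ → N.V, SideData N.G H.verts k P (fun i => ℓ (i - 1)) ∧ P 0 = s ∧ P (k + 1) = t ∧
      ∀ i, 1 ≤ i → i ≤ k → P i = p (i - 1) := by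
  let P : ℕ → N.V := fun i => if i = 0 then s else if i ≤ k then p (i - 1) else t
  have hP0 : P 0 = s := rfl
  have hPk : P (k + 1) = t := by simp [P]
  have hPi : ∀ i, 1 ≤ i → i ≤ k → P i = p (i - 1) := fun i h1 h2 => by
    simp only [P]
    rw [if_neg (by omega), if_pos h2]
  have hmem : ∀ i, i ≤ k + 1 → P i ∈ H.verts := by
    intro i hi
    rcases Nat.eq_zero_or_pos i with rfl | hpos
    · exact hs
    rcases Nat.lt_or_ge k i with h | h
    · obtain rfl : i = k + 1 := by omega
      rw [hPk]; exact ht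
    · rw [hPi i hpos h]; exact hp _ (by omega)
  have hPinj : ∀ i j, i < j → j ≤ k + 1 → P i ≠ P j := by
    intro i j hij hj
    rcases Nat.eq_zero_or_pos i with rfl | hpos
    · rw [hP0]
      rcases Nat.lt_or_ge k j with h | h
      · obtain rfl : j = k + 1 := by omega
        rw [hPk]; exact hst
      · rw [hPi j (by omega) h]; exact (hps _ (by omega)).symm
    · rw [hPi i hpos (by omega)]
      rcases Nat.lt_or_ge k j with h | h
      · obtain rfl : j = k + 1 := by omega
        rw [hPk]; exact hpt _ (by omega)
      · rw [hPi j (by omega) h]; exact hinj _ _ (by omega) (by omega)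
  have hPadj : ∀ i, i ≤ k → H.Adj (P i) (P (i + 1)) := by
    intro i hi
    rcases Nat.eq_zero_or_pos i with rfl | hpos
    · rw [hP0, hPi _ le_rfl hk]; exact h0
    rw [hPi i hpos hi]
    rcases Nat.lt_or_ge i k with h | h
    · rw [hPi (i + 1) (by omega) (by omega)]
      have := hadj (i - 1) (by omega)
      rwa [show i - 1 + 1 = i + 1 - 1 by omega] at this
    · obtain rfl : i = k := by omega
      rw [hPk]; exact h1
  refine ⟨P, ⟨hmem, hPinj, ?_, fun i h1 h2 => hl _ (by omega), ?_⟩, hP0, hPk, hPi⟩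
  · intro i hi1 hi2
    have hA := (hPadj (i - 1) (by omega)).symm
    rw [show i - 1 + 1 = i by omega] at hA
    apply set_eq_three
    · rw [hPi i hi1 hi2]; exact hdeg _ (by omega)
    · rw [hPi i hi1 hi2]; exact (hla _ (by omega)).symm
    · exact hA.adj_sub
    · exact (hPadj i hi2).adj_sub
    · intro e
      exact hl (i - 1) (by omega) (e ▸ hmem _ (by omega))
    · intro e
      exact hl (i - 1) (by omega) (e ▸ hmem _ (by omega))
    · exact hPinj _ _ (by omega) (by omega)
  · intro i hi1 hi2 z hz
    rw [hPi i hi1 hi2]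
    exact hln _ (by omega) z hz

end Sides

section Assembly

lemma rep_near {V : Type} [Fintype V] {G : SimpleGraph V} {S : Set V} {u w : V} (hw : w ∉ S)
    (hu : u ∈ S) (huw : G.Adj u w)
    (hcut : ∀ x z, x ∈ S → z ∉ S → G.Adj x z → x = u ∧ z = w)
    [inst : Fintype ({v : V // v ∉ S} ⊕ Unit)] (y : V) (hy : y ∈ S) (c1 c2 c3 c4 : ℕ)
    (htheta : ∀ F : Set V, (∀ z ∈ F, z ∉ S) → w ∈ F →
      plen G F u y = {c1} + {c2} + {c3} + {c4}) (x : {v : V // v ∉ S}) (M : Multiset ℕ)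
    (hM : M = plen (repG G S w hw) ∅ (Sum.inl x) (Sum.inr ())) :
    plen G ∅ x.1 y = M.map (· + c1) + M.map (· + c2) + M.map (· + c3) + M.map (· + c4) := by
  let tr : ℕ → Multiset ℕ →+ Multiset ℕ := fun c => Multiset.mapAddMonoidHom (· + c)
  have htr : ∀ c M, tr c M = M.map (· + c) := fun c M => rfl
  have := rep_plen hw hu huw hcut (tr c1 + tr c2 + tr c3 + tr c4)
      (fun M => by
        simp only [AddMonoidHom.add_apply, htr, Multiset.map_add, Multiset.map_map,
          Function.comp_def, add_right_comm _ 1])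
      y (Sum.inr ())
      (fun F x _ h => by
        rcases h with h | h
        · exact absurd (h ▸ hy) x.2
        · cases h)
      (fun F hF hwF => by
        rw [htheta F hF hwF, plen_self repSet_inr]
        simp only [AddMonoidHom.add_apply, htr, Multiset.map_singleton, zero_add])
      ∅ (by simp) x
  rw [show repSet S (∅ : Set V) = ∅ by ext z; simp [repSet]] at this
  rw [this, hM]
  rfl

lemma rep_far {V : Type} [Fintype V] {G : SimpleGraph V} {S : Set V} {u w : V} (hw : w ∉ S)
    (hu : u ∈ S) (huw : G.Adj u w)
    (hcut : ∀ x z, x ∈ S → z ∉ S → G.Adj x z → x = u ∧ z = w)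
    [inst : Fintype ({v : V // v ∉ S} ⊕ Unit)] (x y : {v : V // v ∉ S}) :
    plen (repG G S w hw) ∅ (Sum.inl x) (Sum.inl y) = plen G ∅ x.1 y.1 := by
  have := rep_plen hw hu huw hcut (AddMonoidHom.id _)
      (fun M => rfl) y.1 (Sum.inl y)
      (fun F x hxF h => by
        have hxy : x = y := by
          rcases h with h | h
          · exact Subtype.ext h
          · exact Sum.inl.inj h
        subst hxy
        rw [plen_self hxF, plen_self (fun h => hxF ((repSet_inl _).1 h))]
        rfl)
      (fun F hF hwF => by
        rw [plen_dead_cut hu y.2 (fun x z h1 h2 h3 => (hcut x z h1 h2 h3).2) hwF,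
          plen_dead_source (p := Sum.inl ⟨w, hw⟩) (by simp) _ ((repSet_inl _).2 hwF), map_zero]
        rintro (z | z) hz
        · have := (repG_inl_inr z).1 hz.symm
          exact congrArg Sum.inl (Subtype.ext this)
        · exact absurd rfl hz.ne)
      ∅ (by simp) x
  rw [show repSet S (∅ : Set V) = ∅ by ext z; simp [repSet]] at this
  exact this.symm

lemma blobReplace_dms_near (N : LabGraph X) (R : Set X) (S : Set N.V) (w : N.V)
    (hmem : ∀ x : X, x ∉ R → N.leaf x ∉ S) (hw : w ∉ S)
    [inst : Fintype ({v : N.V // v ∉ S} ⊕ Unit)] (x : X) (hx : x ∉ R) :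
    (N.blobReplace R S w hmem hw).dms (Sum.inl ⟨x, hx⟩) (Sum.inr ()) =
      plen (repG N.G S w hw) ∅ (Sum.inl ⟨N.leaf x, hmem x hx⟩) (Sum.inr ()) := by
  classical
  obtain rfl : inst = (N.blobReplace R S w hmem hw).fV := Subsingleton.elim _ _
  exact dms_eq_plen _ _ _

lemma blobReplace_dms_far (N : LabGraph X) (R : Set X) (S : Set N.V) (w : N.V)
    (hmem : ∀ x : X, x ∉ R → N.leaf x ∉ S) (hw : w ∉ S)
    [inst : Fintype ({v : N.V // v ∉ S} ⊕ Unit)] (x y : X) (hx : x ∉ R) (hy : y ∉ R) :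
    (N.blobReplace R S w hmem hw).dms (Sum.inl ⟨x, hx⟩) (Sum.inl ⟨y, hy⟩) =
      plen (repG N.G S w hw) ∅ (Sum.inl ⟨N.leaf x, hmem x hx⟩)
        (Sum.inl ⟨N.leaf y, hmem y hy⟩) := by
  classical
  obtain rfl : inst = (N.blobReplace R S w hmem hw).fV := Subsingleton.elim _ _
  exact dms_eq_plen _ _ _

lemma four_parts (M T : Multiset ℕ) (k l : ℕ) (hk : 1 ≤ k)
    (hT : T = M.map (· + 3) + M.map (· + (l + 4)) + M.map (· + (k + 2)) + M.map (· + (k + l + 3)))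
    (A1 B1 C1 D1 : Multiset ℕ) (hsum : A1 + B1 + C1 + D1 = T)
    (h1 : zsub A1 3 = zsub B1 (l + 4)) (h2 : zsub A1 3 = zsub C1 (k + 2))
    (h3 : zsub A1 3 = zsub D1 (k + l + 3)) :
    A1 = M.map (· + 3) ∧ B1 = A1.map (· + (l + 1)) ∧
        C1 = A1.map (· + (k - 1)) ∧ D1 = A1.map (· + (k + l)) := by
  have e1 := zsub_eq_iff A1 B1 3 (l + 4) (l + 1) (by omega) (by exact_mod_cast h1)
  have e2 := zsub_eq_iff A1 C1 3 (k + 2) (k - 1) (by omega) (by exact_mod_cast h2)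
  have e3 := zsub_eq_iff A1 D1 3 (k + l + 3) (k + l) (by omega) (by exact_mod_cast h3)
  refine ⟨?_, e1, e2, e3⟩
  apply multiset_four_unique (l + 1) (k - 1) (k + l)
  rw [← e1, ← e2, ← e3, hsum, hT]
  simp only [Multiset.map_map, Function.comp_def, add_assoc]
  rw [show 3 + (l + 1) = l + 4 by omega, show 3 + (k - 1) = k + 2 by omega,
    show 3 + (k + l) = k + (l + 3) by omega]

lemma zsub_shift (M : Multiset ℕ) (c : ℕ) : zsub (M.map (· + c)) c = toZ M := by
  rw [zsub_def, toZ_def, Multiset.map_map]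
  refine Multiset.map_congr rfl fun t _ => ?_
  simp

lemma four_exists_unique (M T : Multiset ℕ) (k l : ℕ) (hk : 1 ≤ k)
    (hT : T = M.map (· + 3) + M.map (· + (l + 4)) + M.map (· + (k + 2)) +
      M.map (· + (k + l + 3))) :
    ∃! Q : Multiset ℕ × Multiset ℕ × Multiset ℕ × Multiset ℕ,
        Q.1 + Q.2.1 + Q.2.2.1 + Q.2.2.2 = T ∧
        Multiset.card Q.1 = Multiset.card Q.2.1 ∧
        Multiset.card Q.1 = Multiset.card Q.2.2.1 ∧
        Multiset.card Q.1 = Multiset.card Q.2.2.2 ∧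
        zsub Q.1 3 = zsub Q.2.1 (l + 4) ∧
        zsub Q.1 3 = zsub Q.2.2.1 (k + 2) ∧
        zsub Q.1 3 = zsub Q.2.2.2 (k + l + 3) := by
  have z1 := zsub_shift M 3
  have z2 := zsub_shift M (l + 4)
  have z3 := zsub_shift M (k + 2)
  have z4 := zsub_shift M (k + l + 3)
  push_cast at z1 z2 z3 z4
  refine ⟨(M.map (· + 3), M.map (· + (l + 4)), M.map (· + (k + 2)), M.map (· + (k + l + 3))),
    ⟨hT.symm, by simp, by simp, by simp, z1.trans z2.symm, z1.trans z3.symm,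
      z1.trans z4.symm⟩, ?_⟩
  rintro ⟨A1, B1, C1, D1⟩ ⟨h1, _, _, _, h2, h3, h4⟩
  obtain ⟨e1, e2, e3, e4⟩ := four_parts M T k l hk hT A1 B1 C1 D1 h1 h2 h3 h4
  obtain ⟨-, f2, f3, f4⟩ := four_parts M T k l hk hT _ _ _ _ hT.symm (z1.trans z2.symm)
    (z1.trans z3.symm) (z1.trans z4.symm)
  subst e1
  rw [e2, e3, e4, f2, f3, f4]

lemma dms_near (N : LabGraph X) (R : Set X) (S : Set N.V) (u w : N.V)
    (hmem : ∀ x : X, x ∉ R → N.leaf x ∉ S) (hw : w ∉ S) (hu : u ∈ S) (huw : N.G.Adj u w)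
    (hcut : ∀ x z, x ∈ S → z ∉ S → N.G.Adj x z → x = u ∧ z = w) (y : X) (hy : N.leaf y ∈ S)
    (c1 c2 c3 c4 : ℕ)
    (htheta : ∀ F : Set N.V, (∀ z ∈ F, z ∉ S) → w ∈ F →
      plen N.G F u (N.leaf y) = {c1} + {c2} + {c3} + {c4}) (x : X) (hx : x ∉ R)
    (M : Multiset ℕ)
    (hM : M = (N.blobReplace R S w hmem hw).dms (Sum.inl ⟨x, hx⟩) (Sum.inr ())) :
    N.dms x y = M.map (· + c1) + M.map (· + c2) + M.map (· + c3) + M.map (· + c4) := by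
  classical
  rw [dms_eq_plen]
  rw [blobReplace_dms_near] at hM
  exact rep_near hw hu huw hcut (N.leaf y) hy c1 c2 c3 c4 htheta ⟨N.leaf x, hmem x hx⟩ M hM

lemma dms_far (N : LabGraph X) (R : Set X) (S : Set N.V) (u w : N.V)
    (hmem : ∀ x : X, x ∉ R → N.leaf x ∉ S) (hw : w ∉ S) (hu : u ∈ S) (huw : N.G.Adj u w)
    (hcut : ∀ x z, x ∈ S → z ∉ S → N.G.Adj x z → x = u ∧ z = w) (x y : X)
    (hx : x ∉ R) (hy : y ∉ R) :
    (N.blobReplace R S w hmem hw).dms (Sum.inl ⟨x, hx⟩) (Sum.inl ⟨y, hy⟩) = N.dms x y := by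
  classical
  rw [blobReplace_dms_far, dms_eq_plen]
  exact rep_far hw hu huw hcut ⟨N.leaf x, hmem x hx⟩ ⟨N.leaf y, hmem y hy⟩

end Assembly

set_option maxHeartbeats 1000000 in
lemma structure_core (N : LabGraph X) (hN : N.IsNetwork)
    (k l : ℕ) (hk : 1 ≤ k) (h0 : 0 < k) (hl : 1 ≤ l) (a : Fin k → X) (b : Fin l → X)
    (H : N.G.Subgraph) (u w : N.V)
    (hform : N.IsFormBlob H u w k l 0 0 a b Fin.elim0 Fin.elim0) :
    N.G.Connected ∧ Function.Injective N.leaf ∧ (∀ x : X, N.degOf (N.leaf x) = 1) ∧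
    (∀ v : N.V, v ∉ Set.range N.leaf → N.degOf v = 3) ∧ N.G.Adj u w ∧
    u ∈ H.verts ∪ N.leaf '' (Set.range a ∪ Set.range b) ∧
    (∀ x z, x ∈ H.verts ∪ N.leaf '' (Set.range a ∪ Set.range b) →
      z ∉ H.verts ∪ N.leaf '' (Set.range a ∪ Set.range b) → N.G.Adj x z → x = u ∧ z = w) ∧
    N.leaf (a ⟨0, h0⟩) ∈ H.verts ∪ N.leaf '' (Set.range a ∪ Set.range b) ∧
    ∀ F : Set N.V, (∀ z ∈ F, z ∉ H.verts ∪ N.leaf '' (Set.range a ∪ Set.range b)) → w ∈ F →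
      plen N.G F u (N.leaf (a ⟨0, h0⟩)) = {3} + {l + 4} + {k + 2} + {k + l + 3} := by
  classical
  obtain ⟨hconn, hinj, hdeg⟩ := hN
  obtain ⟨⟨hblob, hpend⟩, hrank, hcutuw, hntriv, hu, hw, -, -, -, -, hinja, hinjb, -, -,
    hab, -, -, -, -, -, hleafin, hca, hcb, -, -, hsab, hsa, hsb, -⟩ := hform
  have hcard : 3 ≤ Fintype.card N.V := by
    refine hblob.1.1.trans ?_
    rw [← Nat.card_eq_fintype_card, ← Set.ncard_univ]
    exact Set.ncard_le_ncard (Set.subset_univ _) (Set.toFinite _)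
  obtain ⟨hdeg1, hdeg3⟩ : (∀ x : X, N.degOf (N.leaf x) = 1) ∧
      ∀ v : N.V, v ∉ Set.range N.leaf → N.degOf v = 3 := by
    rcases hdeg with h | h
    · omega
    · exact h
  have hdegH : ∀ v ∈ H.verts, (N.G.neighborSet v).ncard = 3 := fun v hv =>
    hdeg3 v (blob_not_leaf hblob hdeg1 hv)
  have huw : N.G.Adj u w := hcutuw.1
  -- neighbours of leaves
  have hnb0 : ∀ x : X, ∃ v, N.G.neighborSet (N.leaf x) = {v} := fun x =>
    Set.ncard_eq_one.1 (hdeg1 x)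
  choose nb hnb using hnb0
  have hnbadj : ∀ x, N.G.Adj (N.leaf x) (nb x) := fun x => by
    have : nb x ∈ N.G.neighborSet (N.leaf x) := by rw [hnb]; rfl
    exact this
  have hnbuniq : ∀ x z, N.G.Adj (N.leaf x) z → z = nb x := fun x z hz => by
    have : z ∈ N.G.neighborSet (N.leaf x) := hz
    rw [hnb] at this
    exact this
  have hleafH : ∀ x, N.leaf x ∉ H.verts := fun x hx => blob_not_leaf hblob hdeg1 hx ⟨x, rfl⟩
  have hnbH : ∀ x, N.LeafInBlob x H → nb x ∈ H.verts := by
    rintro x ⟨v, hv, hvH⟩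
    rw [← hnbuniq x v hv]
    exact hvH
  have hnbdeg : ∀ x, N.LeafInBlob x H → (H.neighborSet (nb x)).ncard ≤ 2 := fun x hx =>
    blob_outer_deg hblob hdeg1 hdeg3 (hnbH x hx) (hleafH x) (hnbadj x).symm
  have hnbbr : ∀ x, N.LeafInBlob x H → nb x ∉ N.branchVerts H := fun x hx hb => by
    have h1 := hnbdeg x hx
    have h2 := hb.2
    omega
  have hubr : u ∉ N.branchVerts H := fun hb => by
    have h1 := blob_outer_deg hblob hdeg1 hdeg3 hu hw huw
    have h2 := hb.2
    omega
  have hnbinj : ∀ x y, N.LeafInBlob x H → nb x = nb y → x = y := by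
    intro x y hx e
    obtain ⟨y1, y2, _, h1, h2, h3⟩ := blob_outer hblob hdeg1 hdeg3 (hnbH x hx) (hleafH x)
      (hnbadj x).symm
    have : N.leaf y ∈ N.G.neighborSet (nb x) := by rw [e]; exact (hnbadj y).symm
    rw [h3] at this
    rcases this with h | h | h
    · exact (hinj h).symm
    · exact absurd (h ▸ h1.snd_mem) (hleafH y)
    · exact absurd (h ▸ h2.snd_mem) (hleafH y)
  have hnbu : ∀ x, N.LeafInBlob x H → nb x ≠ u := by
    intro x hx e
    obtain ⟨y1, y2, _, h1, h2, h3⟩ := blob_outer hblob hdeg1 hdeg3 hu hw huw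
    have : N.leaf x ∈ N.G.neighborSet u := by rw [← e]; exact (hnbadj x).symm
    rw [h3] at this
    rcases this with h | h | h
    · exact hntriv ⟨x, by rw [h]; simp⟩
    · exact absurd (h ▸ h1.snd_mem) (hleafH x)
    · exact absurd (h ▸ h2.snd_mem) (hleafH x)
  -- outer edges
  have houter : ∀ v v', v ∈ H.verts → v' ∉ H.verts → N.G.Adj v v' →
      (∃ x, v' = N.leaf x ∧ v = nb x ∧ N.LeafInBlob x H) ∨ (v = u ∧ v' = w) := by
    intro v v' hv hv' ha
    have hc := blob_outer_cut hblob hdeg1 hdeg3 hv hv' ha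
    by_cases htr : N.TrivialEdge s(v, v')
    · obtain ⟨x, hx⟩ := htr
      rw [Sym2.mem_iff] at hx
      rcases hx with hx | hx
      · exact absurd (hx ▸ hv) (hleafH x)
      · left
        subst hx
        exact ⟨x, rfl, hnbuniq x v ha.symm, v, ha.symm, hv⟩
    · right
      have := hpend.unique (y₁ := s(v, v')) (y₂ := s(u, w)) ⟨hc, htr, v, hv, by simp⟩
        ⟨hcutuw, hntriv, u, hu, by simp⟩
      rw [Sym2.eq_iff] at this
      rcases this with h | h
      · exact h
      · exact absurd (h.1 ▸ hv) hw
  -- the chains as functions on ℕ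
  obtain ⟨A, hA⟩ : ∃ A : ℕ → X, ∀ i (h : i < k), A i = a ⟨i, h⟩ :=
    ⟨fun i => if h : i < k then a ⟨i, h⟩ else a ⟨0, h0⟩, fun i h => by simp [h]⟩
  obtain ⟨B, hB⟩ : ∃ B : ℕ → X, ∀ i (h : i < l), B i = b ⟨i, h⟩ :=
    ⟨fun i => if h : i < l then b ⟨i, h⟩ else b ⟨0, hl⟩, fun i h => by simp [h]⟩
  have hAin : ∀ i < k, N.LeafInBlob (A i) H := fun i hi =>
    (hleafin _).2 (Or.inl ⟨⟨i, hi⟩, (hA i hi).symm⟩)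
  have hBin : ∀ i < l, N.LeafInBlob (B i) H := fun i hi =>
    (hleafin _).2 (Or.inr (Or.inl ⟨⟨i, hi⟩, (hB i hi).symm⟩))
  have hAB : ∀ x, N.LeafInBlob x H → (∃ i < k, x = A i) ∨ (∃ j < l, x = B j) := by
    intro x hx
    rcases (hleafin x).1 hx with ⟨i, rfl⟩ | ⟨i, rfl⟩ | ⟨i, _⟩ | ⟨i, _⟩
    · exact Or.inl ⟨i.1, i.2, (hA i.1 i.2).symm⟩
    · exact Or.inr ⟨i.1, i.2, (hB i.1 i.2).symm⟩
    · exact i.elim0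
    · exact i.elim0
  have hABne : ∀ i < k, ∀ j < l, A i ≠ B j := by
    intro i hi j hj e
    have : A i ∈ Set.range a ∩ Set.range b :=
      ⟨⟨⟨i, hi⟩, (hA i hi).symm⟩, ⟨⟨j, hj⟩, by rw [e, hB j hj]⟩⟩
    rw [hab] at this
    exact this
  have hAne : ∀ i j, i < j → j < k → A i ≠ A j := by
    intro i j hij hj e
    rw [hA i (by omega), hA j hj] at e
    have := congrArg Fin.val (hinja e)
    simp at this
    omega
  have hBne : ∀ i j, i < j → j < l → B i ≠ B j := by
    intro i j hij hj e
    rw [hB i (by omega), hB j hj] at e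
    have := congrArg Fin.val (hinjb e)
    simp at this
    omega
  -- the branch vertices
  have hbr2 := branch_two hblob hdeg1 hdeg3 hrank
  have hclass : ∀ v ∈ H.verts, v ∈ N.branchVerts H ∨ v = u ∨ (∃ i < k, v = nb (A i)) ∨
      ∃ j < l, v = nb (B j) := by
    intro v hv
    by_cases hvb : v ∈ N.branchVerts H
    · exact Or.inl hvb
    right
    have hlt : (H.neighborSet v).ncard < (N.G.neighborSet v).ncard := by
      rw [hdegH v hv]
      by_contra hcon
      exact hvb ⟨hv, by omega⟩
    obtain ⟨v', h1, h2⟩ := Set.exists_mem_notMem_of_ncard_lt_ncard hlt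
    have hv' : v' ∉ H.verts := fun hv' => h2 (blob_adj hblob hv hv' h1)
    rcases houter v v' hv hv' h1 with ⟨x, _, rfl, hx⟩ | ⟨h, _⟩
    · rcases hAB x hx with ⟨i, hi, rfl⟩ | ⟨i, hi, rfl⟩
      · exact Or.inr (Or.inl ⟨i, hi, rfl⟩)
      · exact Or.inr (Or.inr ⟨i, hi, rfl⟩)
    · exact Or.inl h
  have hclA : ∀ i < k, ∀ z, H.Adj (nb (A i)) z → z ∈ N.branchVerts H ∨ ∃ j < k, z = nb (A j) := by
    intro i hi z hz
    by_cases hzb : z ∈ N.branchVerts H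
    · exact Or.inl hzb
    have hss := sameSide_of_adj hz (hnbbr _ (hAin i hi)) hzb
    rcases hclass z hz.snd_mem with h | rfl | h | ⟨j, hj, rfl⟩
    · exact absurd h hzb
    · exact absurd hss (hsa ⟨i, hi⟩ _ (hA i hi ▸ hnbadj (A i)))
    · exact Or.inr h
    · exact absurd hss (hsab ⟨i, hi⟩ ⟨j, hj⟩ _ _ (hA i hi ▸ hnbadj (A i)) (hB j hj ▸ hnbadj (B j)))
  have hclB : ∀ i < l, ∀ z, H.Adj (nb (B i)) z → z ∈ N.branchVerts H ∨ ∃ j < l, z = nb (B j) := by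
    intro i hi z hz
    by_cases hzb : z ∈ N.branchVerts H
    · exact Or.inl hzb
    rcases hclass z hz.snd_mem with h | rfl | ⟨j, hj, rfl⟩ | h
    · exact absurd h hzb
    · exact absurd (sameSide_of_adj hz (hnbbr _ (hBin i hi)) hzb)
        (hsb ⟨i, hi⟩ _ (hB i hi ▸ hnbadj (B i)))
    · exact absurd (sameSide_of_adj hz.symm hzb (hnbbr _ (hBin i hi)))
        (hsab ⟨j, hj⟩ ⟨i, hi⟩ _ _ (hA j hj ▸ hnbadj (A j)) (hB i hi ▸ hnbadj (B i)))
    · exact Or.inr h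
  have hclu : ∀ z, H.Adj u z → z ∈ N.branchVerts H := by
    intro z hz
    by_contra hzb
    have hss := sameSide_of_adj hz.symm hzb hubr
    rcases hclass z hz.snd_mem with h | rfl | ⟨j, hj, rfl⟩ | ⟨j, hj, rfl⟩
    · exact absurd h hzb
    · exact hz.adj_sub.ne rfl
    · exact absurd hss (hsa ⟨j, hj⟩ _ (hA j hj ▸ hnbadj (A j)))
    · exact absurd hss (hsb ⟨j, hj⟩ _ (hB j hj ▸ hnbadj (B j)))
  have hAadj : ∀ i, i + 1 < k → H.Adj (nb (A i)) (nb (A (i + 1))) := fun i hi =>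
    hca i hi _ _ (hA i (by omega) ▸ hnbadj (A i)) (hA (i + 1) hi ▸ hnbadj (A (i + 1)))
  have hBadj : ∀ i, i + 1 < l → H.Adj (nb (B i)) (nb (B (i + 1))) := fun i hi =>
    hcb i hi _ _ (hB i (by omega) ▸ hnbadj (B i)) (hB (i + 1) hi ▸ hnbadj (B (i + 1)))
  have hAinj : ∀ i j, i < j → j < k → nb (A i) ≠ nb (A j) := fun i j hij hj e =>
    hAne i j hij hj (hnbinj _ _ (hAin i (by omega)) e)
  have hBinj : ∀ i j, i < j → j < l → nb (B i) ≠ nb (B j) := fun i j hij hj e =>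
    hBne i j hij hj (hnbinj _ _ (hBin i (by omega)) e)
  obtain ⟨s, t, hst, hbr, hs0, ht0⟩ : ∃ s t, s ≠ t ∧ N.branchVerts H = {s, t} ∧
      H.Adj s (nb (A 0)) ∧ H.Adj (nb (A (k - 1))) t := by
    obtain ⟨s, t, hst, hbr⟩ := Set.ncard_eq_two.1 hbr2
    have hsb' : s ∈ N.branchVerts H := by rw [hbr]; simp
    have htb' : t ∈ N.branchVerts H := by rw [hbr]; simp
    rcases side_ends hblob.1 hsb'.1 htb'.1 hst hu (fun e => hubr (e ▸ hsb'))
      (fun e => hubr (e ▸ htb')) k hk (fun i => nb (A i)) (fun i hi => hnbH _ (hAin i hi))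
      (fun i hi e => hnbbr _ (hAin i hi) (e ▸ hsb')) (fun i hi e => hnbbr _ (hAin i hi) (e ▸ htb'))
      (fun i hi => hnbu _ (hAin i hi)) hAinj hAadj
      (fun i hi z hz => by
        rcases hclA i hi z hz with h | h
        · rw [hbr] at h
          rcases h with h | h
          · exact Or.inl h
          · exact Or.inr (Or.inl h)
        · exact Or.inr (Or.inr h)) (fun i hi => hnbdeg _ (hAin i hi)) with h | h
    · exact ⟨s, t, hst, hbr, h⟩
    · exact ⟨t, s, hst.symm, by rw [hbr, Set.pair_comm], h⟩
  have hsb' : s ∈ N.branchVerts H := by rw [hbr]; simp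
  have htb' : t ∈ N.branchVerts H := by rw [hbr]; simp
  obtain ⟨P, hP, hP0, hPk, hPi⟩ := mk_side hsb'.1 htb'.1 hst k hk (fun i => nb (A i))
    (fun i => N.leaf (A i)) (fun i hi => hnbH _ (hAin i hi))
    (fun i hi e => hnbbr _ (hAin i hi) (e ▸ hsb')) (fun i hi e => hnbbr _ (hAin i hi) (e ▸ htb'))
    hAinj hAadj (fun i hi => hdegH _ (hnbH _ (hAin i hi))) (fun i _ => hleafH _)
    (fun i _ => hnbadj _) (fun i _ => hnbuniq _) hs0 ht0
  obtain ⟨Q, ℓQ, hQ, hQ0, hQl, hQi⟩ : ∃ Q ℓQ, SideData N.G H.verts l Q ℓQ ∧ Q 0 = s ∧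
      Q (l + 1) = t ∧ ∀ i, 1 ≤ i → i ≤ l → ∃ j < l, Q i = nb (B j) ∧ ℓQ i = N.leaf (B j) := by
    rcases side_ends hblob.1 hsb'.1 htb'.1 hst hu (fun e => hubr (e ▸ hsb'))
      (fun e => hubr (e ▸ htb')) l hl (fun i => nb (B i)) (fun i hi => hnbH _ (hBin i hi))
      (fun i hi e => hnbbr _ (hBin i hi) (e ▸ hsb')) (fun i hi e => hnbbr _ (hBin i hi) (e ▸ htb'))
      (fun i hi => hnbu _ (hBin i hi)) hBinj hBadj
      (fun i hi z hz => by
        rcases hclB i hi z hz with h | h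
        · rw [hbr] at h
          rcases h with h | h
          · exact Or.inl h
          · exact Or.inr (Or.inl h)
        · exact Or.inr (Or.inr h)) (fun i hi => hnbdeg _ (hBin i hi)) with ⟨h1, h2⟩ | ⟨h1, h2⟩
    · obtain ⟨Q, hQ, hQ0, hQk, hQi⟩ := mk_side hsb'.1 htb'.1 hst l hl (fun i => nb (B i))
        (fun i => N.leaf (B i)) (fun i hi => hnbH _ (hBin i hi))
        (fun i hi e => hnbbr _ (hBin i hi) (e ▸ hsb'))
        (fun i hi e => hnbbr _ (hBin i hi) (e ▸ htb'))
        hBinj hBadj (fun i hi => hdegH _ (hnbH _ (hBin i hi))) (fun i _ => hleafH _)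
        (fun i _ => hnbadj _) (fun i _ => hnbuniq _) h1 h2
      exact ⟨Q, _, hQ, hQ0, hQk, fun i h1 h2 => ⟨i - 1, by omega, hQi i h1 h2, rfl⟩⟩
    · obtain ⟨Q, hQ, hQ0, hQk, hQi⟩ := mk_side htb'.1 hsb'.1 hst.symm l hl (fun i => nb (B i))
        (fun i => N.leaf (B i)) (fun i hi => hnbH _ (hBin i hi))
        (fun i hi e => hnbbr _ (hBin i hi) (e ▸ htb'))
        (fun i hi e => hnbbr _ (hBin i hi) (e ▸ hsb'))
        hBinj hBadj (fun i hi => hdegH _ (hnbH _ (hBin i hi))) (fun i _ => hleafH _)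
        (fun i _ => hnbadj _) (fun i _ => hnbuniq _) h1 h2
      refine ⟨_, _, hQ.reverse, by simpa using hQk, by simpa using hQ0, fun i h1 h2 =>
        ⟨l + 1 - i - 1, by omega, hQi _ (by omega) (by omega), rfl⟩⟩
  have hPu : ∀ i, i ≤ k + 1 → P i ≠ u := by
    intro i hi e
    rcases Nat.eq_zero_or_pos i with rfl | hpos
    · exact hubr (by rw [← e, hP0]; exact hsb')
    rcases Nat.lt_or_ge k i with h | h
    · obtain rfl : i = k + 1 := by omega
      exact hubr (by rw [← e, hPk]; exact htb')
    · rw [hPi i hpos h] at e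
      exact hnbu _ (hAin _ (by omega)) e
  have hQu : ∀ i, i ≤ l + 1 → Q i ≠ u := by
    intro i hi e
    rcases Nat.eq_zero_or_pos i with rfl | hpos
    · exact hubr (by rw [← e, hQ0]; exact hsb')
    rcases Nat.lt_or_ge l i with h | h
    · obtain rfl : i = l + 1 := by omega
      exact hubr (by rw [← e, hQl]; exact htb')
    · obtain ⟨j, hj, hQj, _⟩ := hQi i hpos h
      rw [hQj] at e
      exact hnbu _ (hBin _ (by omega)) e
  have hPQ : ∀ i j, 1 ≤ i → i ≤ k → 1 ≤ j → j ≤ l → P i ≠ Q j := by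
    intro i j hi1 hi2 hj1 hj2 e
    obtain ⟨j', hj', hQj, _⟩ := hQi j hj1 hj2
    rw [hPi i hi1 hi2, hQj] at e
    exact hABne _ (by omega) _ hj' (hnbinj _ _ (hAin _ (by omega)) e)
  obtain ⟨hus, hut⟩ : H.Adj u s ∧ H.Adj u t := by
    obtain ⟨y1, y2, hne, h1, h2⟩ := two_nbrs hblob.1 hu
    have e1 := hclu y1 h1
    have e2 := hclu y2 h2
    rw [hbr] at e1 e2
    rcases e1 with rfl | rfl <;> rcases e2 with rfl | rfl
    · exact absurd rfl hne
    · exact ⟨h1, h2⟩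
    · exact ⟨h2, h1⟩
    · exact absurd rfl hne
  have hws : w ≠ s := fun e => hw (e ▸ hsb'.1)
  have hwt : w ≠ t := fun e => hw (e ▸ htb'.1)
  have hNu : N.G.neighborSet u = {w, s, t} :=
    set_eq_three (hdegH u hu) huw hus.adj_sub hut.adj_sub hws hwt hst
  have hNs : N.G.neighborSet s = {P 1, Q 1, u} := by
    refine set_eq_three (hdegH s hsb'.1) ?_ ?_ hus.adj_sub.symm
      (hPQ 1 1 le_rfl hk le_rfl hl) (hPu 1 (by omega)) (hQu 1 (by omega))
    · have : P 0 ∈ N.G.neighborSet (P 1) := by rw [hP.nbr 1 le_rfl hk]; simp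
      rw [hP0] at this
      exact SimpleGraph.Adj.symm this
    · have : Q 0 ∈ N.G.neighborSet (Q 1) := by rw [hQ.nbr 1 le_rfl hl]; simp
      rw [hQ0] at this
      exact SimpleGraph.Adj.symm this
  have hNt : N.G.neighborSet t = {P k, Q l, u} := by
    refine set_eq_three (hdegH t htb'.1) ?_ ?_ hut.adj_sub.symm
      (hPQ k l hk le_rfl hl le_rfl) (hPu k (by omega)) (hQu l (by omega))
    · have : P (k + 1) ∈ N.G.neighborSet (P k) := by rw [hP.nbr k hk le_rfl]; simp
      rw [hPk] at this
      exact SimpleGraph.Adj.symm this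
    · have : Q (l + 1) ∈ N.G.neighborSet (Q l) := by rw [hQ.nbr l hl le_rfl]; simp
      rw [hQl] at this
      exact SimpleGraph.Adj.symm this
  obtain ⟨R, hR⟩ : ∃ R : Set X, R = Set.range a ∪ Set.range b := ⟨_, rfl⟩
  rw [← hR]
  obtain ⟨S, hS⟩ : ∃ S : Set N.V, S = H.verts ∪ N.leaf '' R := ⟨_, rfl⟩
  rw [← hS]
  have huS : u ∈ S := hS ▸ Or.inl hu
  have hRin : ∀ x, x ∈ R ↔ N.LeafInBlob x H := by
    intro x
    rw [hleafin, hR]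
    constructor
    · rintro (h | h)
      · exact Or.inl h
      · exact Or.inr (Or.inl h)
    · rintro (h | h | ⟨i, _⟩ | ⟨i, _⟩)
      · exact Or.inl h
      · exact Or.inr h
      · exact i.elim0
      · exact i.elim0
  have hcut : ∀ x z, x ∈ S → z ∉ S → N.G.Adj x z → x = u ∧ z = w := by
    intro x z hx hz ha
    rw [hS] at hx hz
    rcases hx with hx | ⟨r, hr, rfl⟩
    · rcases houter x z hx (fun h => hz (Or.inl h)) ha with ⟨r, rfl, _, hr⟩ | h
      · exact absurd (Or.inr ⟨r, (hRin r).2 hr, rfl⟩) hz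
      · exact h
    · refine absurd (Or.inl ?_) hz
      rw [hnbuniq r z ha]
      exact hnbH r ((hRin r).1 hr)
  have hA0 : a ⟨0, h0⟩ = A 0 := (hA 0 (by omega)).symm
  have hA0S : N.leaf (A 0) ∈ S := hS ▸ Or.inr ⟨A 0, (hRin _).2 (hAin 0 (by omega)), rfl⟩
  have htheta : ∀ F : Set N.V, (∀ z ∈ F, z ∉ S) → w ∈ F →
      plen N.G F u (N.leaf (A 0)) = {3} + {l + 4} + {k + 2} + {k + l + 3} := by
    intro F hF hwF
    refine theta_plen hk hl hP hQ hP0 hPk hQ0 hQl hu hw hNu hNs hNt hPQ hPu hQu ?_ ?_ ?_ ?_ hwF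
    · intro i h1 h2 e
      exact hAne 0 (i - 1) (by omega) (by omega) (hinj e).symm
    · intro i h1 h2 e
      obtain ⟨j, hj, _, hQj⟩ := hQi i h1 h2
      rw [hQj] at e
      exact hABne 0 (by omega) j hj (hinj e).symm
    · exact fun z hz hzF => hF z hzF (hS ▸ Or.inl hz)
    · exact fun h => hF _ h hA0S
  exact ⟨hconn, hinj, hdeg1, hdeg3, huw, huS, hcut, hA0 ▸ hA0S, by rw [hA0]; exact htheta⟩

/-- Lemma 10 (pendant level-2 blob `(k,l,0,0)` reduction): let `H` be a pendant
level-2 blob of the form `(k, l, 0, 0)` (`k, l ≥ 1`) with chains `a = (a_1, ..., a_k)`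
and `b = (b_1, ..., b_l)` and non-trivial cut-edge `uw` (`u ∈ H`), in a level-2
network with at least two blobs and all leaves in blobs.  For every leaf `x` off the
two chains, `d(x, a_1)` has a unique partition into four equal-sized multisets
`A, B, C, D` with `A - 3 = B - (l+4) = C - (k+2) = D - (k+l+3)`; replacing the pendant
blob by a new leaf `z` (attached to `w`) yields a network `N'` whose multisets of
distances are unchanged off the chains and satisfy `d^{N'}(x, z) = A - 3`. -/
theorem pendant_level2_blob_kl00_reduction
    (X : Type) [Fintype X] [DecidableEq X]
    (N : LabGraph X) (hN : N.IsNetwork) (hlev : N.IsLevel 2)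
    (hblobs : N.TwoBlobs) (hleaves : N.AllLeavesInBlobs)
    (k l : ℕ) (hk : 1 ≤ k) (hl : 1 ≤ l) (a : Fin k → X) (b : Fin l → X)
    (H : N.G.Subgraph) (u w : N.V)
    (hform : N.IsFormBlob H u w k l 0 0 a b Fin.elim0 Fin.elim0)
    (hmem : ∀ x : X, x ∉ Set.range a ∪ Set.range b →
      N.leaf x ∉ H.verts ∪ N.leaf '' (Set.range a ∪ Set.range b))
    (hw' : w ∉ H.verts ∪ N.leaf '' (Set.range a ∪ Set.range b)) :
    (∀ x : X, x ∉ Set.range a ∪ Set.range b →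
      ∃! Q : Multiset ℕ × Multiset ℕ × Multiset ℕ × Multiset ℕ,
        Q.1 + Q.2.1 + Q.2.2.1 + Q.2.2.2 = N.dms x (a ⟨0, by omega⟩) ∧
        Multiset.card Q.1 = Multiset.card Q.2.1 ∧
        Multiset.card Q.1 = Multiset.card Q.2.2.1 ∧
        Multiset.card Q.1 = Multiset.card Q.2.2.2 ∧
        zsub Q.1 3 = zsub Q.2.1 (l + 4) ∧
        zsub Q.1 3 = zsub Q.2.2.1 (k + 2) ∧
        zsub Q.1 3 = zsub Q.2.2.2 (k + l + 3)) ∧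
    ∀ N' : LabGraph ({x : X // x ∉ Set.range a ∪ Set.range b} ⊕ Unit),
      N' = N.blobReplace (Set.range a ∪ Set.range b)
          (H.verts ∪ N.leaf '' (Set.range a ∪ Set.range b)) w hmem hw' →
      (N'.IsNetwork ∧
        (∀ (x y : X) (hx : x ∉ Set.range a ∪ Set.range b)
            (hy : y ∉ Set.range a ∪ Set.range b),
          N'.dms (Sum.inl ⟨x, hx⟩) (Sum.inl ⟨y, hy⟩) = N.dms x y) ∧
        (∀ (x : X) (hx : x ∉ Set.range a ∪ Set.range b) (A B C D : Multiset ℕ),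
          A + B + C + D = N.dms x (a ⟨0, by omega⟩) →
          Multiset.card A = Multiset.card B →
          Multiset.card A = Multiset.card C →
          Multiset.card A = Multiset.card D →
          zsub A 3 = zsub B (l + 4) →
          zsub A 3 = zsub C (k + 2) →
          zsub A 3 = zsub D (k + l + 3) →
          toZ (N'.dms (Sum.inl ⟨x, hx⟩) (Sum.inr ())) = zsub A 3)) := by
  obtain ⟨hconn, hinj, hdeg1, hdeg3, huw, huS, hcut, hA0S, htheta⟩ :=
    structure_core N hN k l hk (by omega) hl a b H u w hform
  have hnear := dms_near N _ _ u w hmem hw' huS huw hcut (a ⟨0, by omega⟩) hA0S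
    3 (l + 4) (k + 2) (k + l + 3) htheta
  refine ⟨fun x hx => ?_, ?_⟩
  · exact four_exists_unique _ _ k l hk (hnear x hx _ rfl)
  · rintro N'' rfl
    refine ⟨?_, ?_, ?_⟩
    · exact blobReplace_isNetwork N _ _ u w hmem hw' (fun x hx => Or.inr ⟨x, hx, rfl⟩) huS huw
        hcut hconn hinj hdeg1 hdeg3
    · exact dms_far N _ _ u w hmem hw' huS huw hcut
    · intro x hx A1 B1 C1 D1 hsum _ _ _ h2 h3 h4
      obtain ⟨e1, -⟩ := four_parts _ _ k l hk (hnear x hx _ rfl) A1 B1 C1 D1 hsum h2 h3 h4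
      rw [e1]
      exact (zsub_shift _ 3).symm

end LabGraph
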